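/- arXiv:2512.09428 — 3 statements merged into one kernel-verified Lean document; each statement's English description precedes it below -/
import Mathlib

section
/- Let K be an algebraically closed field of characteristic 0, let 1 ≤ r ≤ n with r + n ≤ 11, and set d = n + r + 2. Given vectors b_1,…,b_n ∈ K^r, c_1,…,c_n ∈ K^n, f_1,…,f_n ∈ K^n and matrices D_1,…,D_n ∈ M_{r×n}(K), for i = 1,…,n let A_i denote the d×d matrix with rows and columns partitioned into blocks of sizes 1, r, n, 1, whose only possibly nonzero blocks are the (1,2) block b_iᵀ, the (1,3) block c_iᵀ, the (2,3) block D_i and the (3,4) block f_i. Assume: A_1,…,A_n pairwise commute; f_1,…,f_n are linearly independent; the images of D_1,…,D_n together span K^r; and b_1,…,b_n span K^r. Then (A_1,…,A_n) lies in the Zariski closure of the set of simultaneously diagonalizable n-tuples of d×d matrices. (Algebras corresponding to n-tuples from the locus X_{n,r,r} are smoothable when r ≤ n and r + n ≤ 11.) -/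
open Matrix

/-- A tuple of square matrices is simultaneously diagonalizable. -/
def SimDiag {K : Type*} [Field K] {N ι : Type*} [Fintype ι] [DecidableEq ι]
    (A : N → Matrix ι ι K) : Prop :=
  ∃ P : Matrix ι ι K, IsUnit P ∧ ∀ i, (P⁻¹ * A i * P).IsDiag

/-- A tuple of square matrices lies in the Zariski closure of the set of simultaneously
diagonalizable tuples (the principal component): every polynomial in the matrix entries
vanishing on all simultaneously diagonalizable tuples vanishes at the given tuple. -/
def InSimDiagClosure {K : Type*} [Field K] {N ι : Type*} [Fintype ι] [DecidableEq ι]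
    (A : N → Matrix ι ι K) : Prop :=
  ∀ Φ : MvPolynomial (N × ι × ι) K,
    (∀ B : N → Matrix ι ι K, SimDiag B →
      MvPolynomial.eval (fun x => B x.1 x.2.1 x.2.2) Φ = 0) →
    MvPolynomial.eval (fun x => A x.1 x.2.1 x.2.2) Φ = 0

/-- The `d×d` block matrix (`d = 1 + r + n + 1`) with blocks of sizes 1, r, n, 1, whose only
nonzero blocks are the (1,2) block `bᵀ`, the (1,3) block `cᵀ`, the (2,3) block `D` and the
(3,4) block `f`. -/
def blockMat1rn1 {K : Type*} [Field K] {r n : ℕ} (b : Fin r → K) (c : Fin n → K)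
    (D : Matrix (Fin r) (Fin n) K) (f : Fin n → K) :
    Matrix (Fin 1 ⊕ (Fin r ⊕ (Fin n ⊕ Fin 1))) (Fin 1 ⊕ (Fin r ⊕ (Fin n ⊕ Fin 1))) K :=
  Matrix.of fun p q =>
    match p, q with
    | Sum.inl _, Sum.inr (Sum.inl a) => b a
    | Sum.inl _, Sum.inr (Sum.inr (Sum.inl a)) => c a
    | Sum.inr (Sum.inl a), Sum.inr (Sum.inr (Sum.inl a')) => D a a'
    | Sum.inr (Sum.inr (Sum.inl a)), Sum.inr (Sum.inr (Sum.inr _)) => f a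
    | _, _ => 0

/-- `g : K → K` is a polynomial function. -/
@[fun_prop]
def PolyFun {K : Type*} [Field K] (g : K → K) : Prop :=
  ∃ p : Polynomial K, ∀ t, p.eval t = g t

namespace PolyFun

variable {K : Type*} [Field K]

@[fun_prop]
lemma const (a : K) : PolyFun fun _ : K => a := ⟨Polynomial.C a, by simp⟩

@[fun_prop]
lemma id : PolyFun fun t : K => t := ⟨Polynomial.X, by simp⟩

@[fun_prop]
lemma add {f g : K → K} (hf : PolyFun f) (hg : PolyFun g) : PolyFun fun t => f t + g t := by
  obtain ⟨p, hp⟩ := hf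
  obtain ⟨q, hq⟩ := hg
  exact ⟨p + q, by simp [hp, hq]⟩

@[fun_prop]
lemma mul {f g : K → K} (hf : PolyFun f) (hg : PolyFun g) : PolyFun fun t => f t * g t := by
  obtain ⟨p, hp⟩ := hf
  obtain ⟨q, hq⟩ := hg
  exact ⟨p * q, by simp [hp, hq]⟩

@[fun_prop]
lemma sub {f g : K → K} (hf : PolyFun f) (hg : PolyFun g) : PolyFun fun t => f t - g t := by
  obtain ⟨p, hp⟩ := hf
  obtain ⟨q, hq⟩ := hg
  exact ⟨p - q, by simp [hp, hq]⟩

@[fun_prop]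
lemma neg {f : K → K} (hf : PolyFun f) : PolyFun fun t => -f t := by
  obtain ⟨p, hp⟩ := hf
  exact ⟨-p, by simp [hp]⟩

@[fun_prop]
lemma pow {f : K → K} (hf : PolyFun f) (n : ℕ) : PolyFun fun t => f t ^ n := by
  obtain ⟨p, hp⟩ := hf
  exact ⟨p ^ n, by simp [hp]⟩

@[fun_prop]
lemma finsetSum {ι : Type*} (s : Finset ι) {f : ι → K → K} (hf : ∀ i, PolyFun (f i)) :
    PolyFun fun t => ∑ i ∈ s, f i t := by
  choose p hp using hf
  exact ⟨∑ i ∈ s, p i, by simp [Polynomial.eval_finsetSum, hp]⟩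

@[fun_prop]
lemma finsetProd {ι : Type*} (s : Finset ι) {f : ι → K → K} (hf : ∀ i, PolyFun (f i)) :
    PolyFun fun t => ∏ i ∈ s, f i t := by
  choose p hp using hf
  exact ⟨∏ i ∈ s, p i, by simp [Polynomial.eval_prod, hp]⟩

lemma det {ι : Type*} [Fintype ι] [DecidableEq ι] {M : K → Matrix ι ι K}
    (hM : ∀ i j, PolyFun fun t => M t i j) : PolyFun fun t => (M t).det := by
  simp only [Matrix.det_apply']
  exact finsetSum _ fun σ => (const _).mul (finsetProd _ fun i => hM _ _)

lemma adjugate {ι : Type*} [Fintype ι] [DecidableEq ι] {M : K → Matrix ι ι K}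
    (hM : ∀ i j, PolyFun fun t => M t i j) (i j : ι) :
    PolyFun fun t => (M t).adjugate i j := by
  simp only [Matrix.adjugate_apply]
  refine det fun k l => ?_
  simp only [Matrix.updateRow_apply]
  split_ifs
  · exact const _
  · exact hM _ _

lemma matrixMul {ι κ ν : Type*} [Fintype κ] {M : K → Matrix ι κ K} {N : K → Matrix κ ν K}
    (hM : ∀ i j, PolyFun fun t => M t i j) (hN : ∀ i j, PolyFun fun t => N t i j) (i : ι) (j : ν) :
    PolyFun fun t => (M t * N t) i j := by
  simp only [Matrix.mul_apply]
  exact finsetSum _ fun k => (hM _ _).mul (hN _ _)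

lemma mvPolynomial_eval {σ : Type*} {x : K → σ → K} (hx : ∀ i, PolyFun fun t => x t i)
    (Φ : MvPolynomial σ K) : PolyFun fun t => MvPolynomial.eval (x t) Φ := by
  induction Φ using MvPolynomial.induction_on with
  | C a => simpa using const a
  | add p q hp hq => simpa using hp.add hq
  | mul_X p n hp => simpa using hp.mul (hx n)

lemma eq_zero_of_mul_eq_zero [Infinite K] {f g : K → K} (hf : PolyFun f) (hg : PolyFun g)
    (h : ∀ t, f t * g t = 0) {t₀ : K} (ht₀ : g t₀ ≠ 0) (t : K) : f t = 0 := by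
  obtain ⟨p, hp⟩ := hf
  obtain ⟨q, hq⟩ := hg
  have hpq : p * q = 0 := Polynomial.funext fun s => by simp [hp, hq, h]
  rcases mul_eq_zero.1 hpq with h0 | h0
  · rw [← hp, h0, Polynomial.eval_zero]
  · rw [← hq, h0, Polynomial.eval_zero] at ht₀
    exact absurd rfl ht₀

end PolyFun

section Closure

variable {K : Type*} [Field K] {N ι : Type*} [Fintype ι] [DecidableEq ι]

lemma SimDiag.inSimDiagClosure {A : N → Matrix ι ι K} (h : SimDiag A) : InSimDiagClosure A :=
  fun _ hΦ => hΦ A h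

/-- The closure is stable along polynomial curves. -/
lemma InSimDiagClosure.of_curve [Infinite K] {A : K → N → Matrix ι ι K} {θ : K → K}
    (hA : ∀ i p q, PolyFun fun t => A t i p q) (hθ : PolyFun θ) {t₀ : K} (ht₀ : θ t₀ ≠ 0)
    (h : ∀ t, θ t ≠ 0 → InSimDiagClosure (A t)) (t : K) : InSimDiagClosure (A t) := by
  intro Φ hΦ
  have hf := PolyFun.mvPolynomial_eval (x := fun t (x : N × ι × ι) => A t x.1 x.2.1 x.2.2)
    (fun x => hA x.1 x.2.1 x.2.2) Φ
  refine hf.eq_zero_of_mul_eq_zero hθ (fun s => ?_) ht₀ t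
  rcases eq_or_ne (θ s) 0 with hs | hs
  · rw [hs, mul_zero]
  · rw [h s hs Φ hΦ, zero_mul]

/-- The closure is stable under polynomial maps which preserve simultaneous diagonalizability. -/
lemma InSimDiagClosure.map {A : N → Matrix ι ι K} (h : InSimDiagClosure A)
    (F : (N → Matrix ι ι K) → N → Matrix ι ι K) (p : N × ι × ι → MvPolynomial (N × ι × ι) K)
    (hp : ∀ B i k l, MvPolynomial.eval (fun x => B x.1 x.2.1 x.2.2) (p (i, k, l)) = F B i k l)
    (hF : ∀ B, SimDiag B → SimDiag (F B)) : InSimDiagClosure (F A) := by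
  intro Φ hΦ
  have key : ∀ B : N → Matrix ι ι K, MvPolynomial.eval (fun x => B x.1 x.2.1 x.2.2)
      (MvPolynomial.bind₁ p Φ) = MvPolynomial.eval (fun x => F B x.1 x.2.1 x.2.2) Φ := by
    intro B
    rw [MvPolynomial.eval, MvPolynomial.eval₂Hom_bind₁]
    congr 2
    funext x
    exact hp B x.1 x.2.1 x.2.2
  rw [← key]
  exact h _ fun B hB => by rw [key]; exact hΦ _ (hF B hB)

lemma InSimDiagClosure.smul {A : N → Matrix ι ι K} (h : InSimDiagClosure A) (a : K) :
    InSimDiagClosure (a • A) := by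
  refine h.map (fun B => a • B) (fun x => MvPolynomial.C a * MvPolynomial.X x)
    (fun B i k l => by simp) ?_
  rintro B ⟨P, hP, hB⟩
  refine ⟨P, hP, fun i => ?_⟩
  have : P⁻¹ * (a • B) i * P = a • (P⁻¹ * B i * P) := by simp
  rw [this]
  exact (hB i).smul a

lemma InSimDiagClosure.of_mul_eq_mul {A B : N → Matrix ι ι K} (h : InSimDiagClosure B)
    {P : Matrix ι ι K} (hP : IsUnit P) (hAB : ∀ i, A i * P = P * B i) : InSimDiagClosure A := by
  have hd : IsUnit P.det := (Matrix.isUnit_iff_isUnit_det P).1 hP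
  have hA : A = fun i => P * B i * P⁻¹ := by
    funext i
    rw [← hAB, Matrix.mul_nonsing_inv_cancel_right _ _ hd]
  rw [hA]
  refine h.map (fun B i => P * B i * P⁻¹)
    (fun x => ∑ j, (∑ j', MvPolynomial.C (P x.2.1 j') * MvPolynomial.X (x.1, j', j)) *
      MvPolynomial.C (P⁻¹ j x.2.2)) (fun B i k l => by simp [Matrix.mul_apply]) ?_
  rintro B ⟨Q, hQ, hB⟩
  refine ⟨P * Q, hP.mul hQ, fun i => ?_⟩
  have : (P * Q)⁻¹ * (P * B i * P⁻¹) * (P * Q) = Q⁻¹ * B i * Q := by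
    rw [Matrix.mul_inv_rev]
    simp only [Matrix.mul_assoc]
    rw [Matrix.nonsing_inv_mul_cancel_left _ _ hd, Matrix.nonsing_inv_mul_cancel_left _ _ hd]
  rw [this]
  exact hB i

/-- A limit of tuples `G⁻¹ M` in the closure lies in the closure. -/
lemma InSimDiagClosure.of_gram_limit [Infinite K] {G : K → Matrix ι ι K}
    {M : K → N → Matrix ι ι K} {A : N → Matrix ι ι K}
    (hG : ∀ p q, PolyFun fun t => G t p q) (hM : ∀ i p q, PolyFun fun t => M t i p q)
    (h : ∀ t, t ≠ 0 → (G t).det ≠ 0 →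
      ∃ B : N → Matrix ι ι K, InSimDiagClosure B ∧ ∀ i, G t * B i = M t i)
    (h0 : (G 0).det ≠ 0) (hA : ∀ i, G 0 * A i = M 0 i) : InSimDiagClosure A := by
  have hdet : PolyFun fun t => (G t).det := PolyFun.det hG
  have hne : ∃ t₀, t₀ * (G t₀).det ≠ 0 := by
    by_contra! hcon
    exact h0 (PolyFun.eq_zero_of_mul_eq_zero hdet PolyFun.id
      (fun t => by rw [mul_comm]; exact hcon t) one_ne_zero 0)
  obtain ⟨t₀, ht₀⟩ := hne
  have hcurve := InSimDiagClosure.of_curve (A := fun t i => (G t).adjugate * M t i)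
    (θ := fun t => t * (G t).det)
    (fun i => PolyFun.matrixMul (PolyFun.adjugate hG) (hM i))
    (PolyFun.id.mul hdet) ht₀ (fun t ht => by
      obtain ⟨B, hB, hGB⟩ := h t (left_ne_zero_of_mul ht) (right_ne_zero_of_mul ht)
      convert hB.smul (G t).det using 1
      funext i
      simp [← hGB, ← Matrix.mul_assoc, Matrix.adjugate_mul]) 0
  convert hcurve.smul (G 0).det⁻¹ using 1
  funext i
  simp [← hA, ← Matrix.mul_assoc, Matrix.adjugate_mul, smul_smul, h0]

end Closure

section Smoothable

open Module

variable {K : Type*} [Field K] {N ι : Type*} [Fintype ι] [DecidableEq ι]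

lemma simDiag_toMatrix {V ι' : Type*} [AddCommGroup V] [Module K V] (β : Basis ι K V)
    (β' : Basis ι' K V) (Y : N → V →ₗ[K] V) (μ : N → ι' → K)
    (hY : ∀ i j, Y i (β' j) = μ i j • β' j) :
    SimDiag fun i => LinearMap.toMatrix β β (Y i) := by
  let e : ι ≃ ι' := β.indexEquiv β'
  let β₂ : Basis ι K V := β'.reindex e.symm
  have h1 : β.toMatrix β₂ * β₂.toMatrix β = 1 := Basis.toMatrix_mul_toMatrix_flip β β₂
  have hinv : (β.toMatrix β₂)⁻¹ = β₂.toMatrix β := Matrix.inv_eq_right_inv h1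
  refine ⟨β.toMatrix β₂, IsUnit.of_mul_eq_one _ h1, fun i => ?_⟩
  rw [hinv, basis_toMatrix_mul_linearMap_toMatrix_mul_basis_toMatrix]
  intro p q hpq
  have hq : Y i (β₂ q) = μ i (e q) • β₂ q := by simp [β₂, hY]
  simp [LinearMap.toMatrix_apply, hq, hpq.symm]

/-- The deformation `(y₀ + y₁ ε) ↦ (y₀ + t y₁) ε` of multiplication by `ε`. -/
def dualNumberDeform {K : Type*} [Field K] (t : K) : DualNumber K →ₗ[K] DualNumber K where
  toFun y := TrivSqZeroExt.inr (y.fst + t * y.snd)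
  map_add' x y := by ext <;> simp; ring
  map_smul' a y := by ext <;> simp; ring

/-- A basis of the dual numbers consisting of eigenvectors of `dualNumberDeform t`. -/
noncomputable def dualNumberBasis {K : Type*} [Field K] (t : K) (ht : t ≠ 0) :
    Basis (Fin 2) K (DualNumber K) :=
  Basis.ofEquivFun
    { toFun := fun y => ![y.fst / t, y.snd + y.fst / t]
      invFun := fun v => TrivSqZeroExt.inl (t * v 0) + TrivSqZeroExt.inr (v 1 - v 0)
      map_add' := fun x y => by
        funext i; fin_cases i <;> simp <;> ring
      map_smul' := fun a y => by
        funext i; fin_cases i <;> simp <;> ring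
      left_inv := fun y => by
        ext <;> simp [mul_div_cancel₀, ht]
      right_inv := fun v => by
        funext i; fin_cases i <;> simp [ht] }

lemma dualNumberDeform_basis {K : Type*} [Field K] (t : K) (ht : t ≠ 0) (i : Fin 2) :
    dualNumberDeform t (dualNumberBasis t ht i) = (![0, t] i : K) • dualNumberBasis t ht i := by
  fin_cases i <;> ext <;> simp [dualNumberBasis, dualNumberDeform]

lemma inSimDiagClosure_leftMulMatrix [Infinite K] {κ : Type*} [Fintype κ] [DecidableEq κ]
    (β : Basis ι K ((κ → K) × DualNumber K)) (x : N → (κ → K) × DualNumber K) :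
    InSimDiagClosure fun i => Algebra.leftMulMatrix β (x i) := by
  let Y : K → N → ((κ → K) × DualNumber K) →ₗ[K] ((κ → K) × DualNumber K) := fun t i =>
    LinearMap.prodMap (LinearMap.mulLeft K (x i).1)
      ((x i).2.fst • LinearMap.id + (x i).2.snd • dualNumberDeform t)
  have hY : ∀ t i v, Y t i v = Y 0 i v + t • ((0 : κ → K),
      (TrivSqZeroExt.inr ((x i).2.snd * v.2.snd) : DualNumber K)) := by
    intro t i v
    refine Prod.ext ?_ ?_
    · simp [Y]
    · ext <;> simp [Y, dualNumberDeform]; ring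
  have hpoly : ∀ i p q, PolyFun fun t => LinearMap.toMatrix β β (Y t i) p q := by
    intro i p q
    have hrw : (fun t => LinearMap.toMatrix β β (Y t i) p q) = fun t =>
        β.repr (Y 0 i (β q)) p + t * β.repr ((0 : κ → K),
          (TrivSqZeroExt.inr ((x i).2.snd * (β q).2.snd) : DualNumber K)) p := by
      funext t
      rw [LinearMap.toMatrix_apply, hY, map_add, map_smul, Finsupp.add_apply,
        Finsupp.smul_apply, smul_eq_mul]
    rw [hrw]
    fun_prop
  have hzero : ∀ i, Algebra.lmul K _ (x i) = Y 0 i := by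
    intro i
    refine LinearMap.ext fun v => Prod.ext ?_ ?_
    · simp [Y]
    · ext <;> simp [Y, dualNumberDeform]
  have hdiag : ∀ t : K, t ≠ 0 → InSimDiagClosure fun i => LinearMap.toMatrix β β (Y t i) := by
    intro t ht
    refine (simDiag_toMatrix β ((Pi.basisFun K κ).prod (dualNumberBasis t ht)) (Y t)
      (fun i => Sum.elim (x i).1 fun j => (x i).2.fst + (x i).2.snd * (![0, t] j : K))
      fun i j => ?_).inSimDiagClosure
    rcases j with j | j
    · refine Prod.ext ?_ ?_
      · funext k
        by_cases hk : k = j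
        · subst hk; simp [Y]
        · simp [Y, hk]
      · simp [Y]
    · refine Prod.ext ?_ ?_
      · simp [Y]
      · simp [Y, dualNumberDeform_basis, add_smul, mul_smul]
  have h := InSimDiagClosure.of_curve (A := fun t i => LinearMap.toMatrix β β (Y t i))
    hpoly PolyFun.id one_ne_zero hdiag 0
  simpa only [Algebra.leftMulMatrix_apply, hzero] using h

end Smoothable

section Degeneration

variable {K : Type*} [Field K]

/-- The tuple of block matrices attached to `b`, `c` and a cubic tensor `T`. -/
def famTuple {r n : ℕ} (b : Fin n → Fin r → K) (c : Fin n → Fin n → K)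
    (T : Fin r → Fin r → Fin r → K) (i : Fin n) :
    Matrix (Fin 1 ⊕ (Fin r ⊕ (Fin n ⊕ Fin 1))) (Fin 1 ⊕ (Fin r ⊕ (Fin n ⊕ Fin 1))) K :=
  blockMat1rn1 (b i) (c i) (Matrix.of fun a j => ∑ e, ∑ f, T a e f * b i e * b j f)
    (Pi.single i 1)

/-- `F` is `t ^ 3` times a polynomial function with value `v` at `0`. -/
def CubicLimit (F : K → K) (v : K) : Prop :=
  ∃ g : K → K, PolyFun g ∧ (∀ t, t ^ 3 * g t = F t) ∧ g 0 = v

variable {r n : ℕ} {R : Type*} [CommRing R] [Algebra K R]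

/-- The family of functionals `L₀ + t L₁`. -/
def pencil (L₀ L₁ : R →ₗ[K] K) (t : K) : R →ₗ[K] K := L₀ + t • L₁

@[fun_prop]
lemma pencil_polyFun (L₀ L₁ : R →ₗ[K] K) (v : R) : PolyFun fun t => pencil L₀ L₁ t v := by
  simp only [pencil, LinearMap.add_apply, LinearMap.smul_apply, smul_eq_mul]
  fun_prop

/-- The rescaled generators of the degeneration. -/
def scaledFrame (x₀ x₁ : Fin n → R) (y : Fin r → R) (z : R) (t : K) :
    Fin 1 ⊕ (Fin r ⊕ (Fin n ⊕ Fin 1)) → R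
  | Sum.inl _ => t ^ 3 • z
  | Sum.inr (Sum.inl a) => t ^ 2 • y a
  | Sum.inr (Sum.inr (Sum.inl i)) => t • x₀ i + t ^ 2 • x₁ i
  | Sum.inr (Sum.inr (Sum.inr _)) => 1

/-- The Gram matrix in the limit. -/
def limitGram (b : Fin n → Fin r → K) (c : Fin n → Fin n → K) (κ : Fin n → K) :
    Matrix (Fin 1 ⊕ (Fin r ⊕ (Fin n ⊕ Fin 1))) (Fin 1 ⊕ (Fin r ⊕ (Fin n ⊕ Fin 1))) K :=
  Matrix.of fun p q =>
    match p, q with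
    | Sum.inl _, Sum.inr (Sum.inr (Sum.inr _)) => 1
    | Sum.inr (Sum.inr (Sum.inr _)), Sum.inl _ => 1
    | Sum.inr (Sum.inl a), Sum.inr (Sum.inr (Sum.inl i)) => b i a
    | Sum.inr (Sum.inr (Sum.inl i)), Sum.inr (Sum.inl a) => b i a
    | Sum.inr (Sum.inr (Sum.inl i)), Sum.inr (Sum.inr (Sum.inl j)) => c i j
    | Sum.inr (Sum.inr (Sum.inl i)), Sum.inr (Sum.inr (Sum.inr _)) => κ i
    | Sum.inr (Sum.inr (Sum.inr _)), Sum.inr (Sum.inr (Sum.inl i)) => κ i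
    | _, _ => 0

lemma limitGram_det_ne_zero {b : Fin n → Fin r → K} {c : Fin n → Fin n → K} (κ : Fin n → K)
    (hbc : ∀ (ξ : Fin n → K) (η : Fin r → K), (∀ a, ∑ i, b i a * ξ i = 0) →
      (∀ i, ∑ a, b i a * η a + ∑ j, c i j * ξ j = 0) → ξ = 0 ∧ η = 0) :
    (limitGram b c κ).det ≠ 0 := by
  intro h
  obtain ⟨v, hv0, hv⟩ := Matrix.exists_mulVec_eq_zero_iff.2 h
  have hz := congrFun hv (Sum.inl 0)
  have hy := fun a => congrFun hv (Sum.inr (Sum.inl a))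
  have hx := fun i => congrFun hv (Sum.inr (Sum.inr (Sum.inl i)))
  have h1 := congrFun hv (Sum.inr (Sum.inr (Sum.inr 0)))
  simp only [Matrix.mulVec, dotProduct, Fintype.sum_sum_type, limitGram, Matrix.of_apply,
    Pi.zero_apply, zero_mul, Finset.sum_const_zero, Fin.sum_univ_one, one_mul, zero_add,
    add_zero] at hz hy hx h1
  obtain ⟨hξ, hη⟩ := hbc (fun i => v (Sum.inr (Sum.inr (Sum.inl i))))
    (fun a => v (Sum.inr (Sum.inl a))) hy (fun i => by simpa [hz] using hx i)
  apply hv0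
  funext p
  rcases p with p | p | p | p
  · fin_cases p
    simpa [fun i => congrFun hξ i] using h1
  · exact congrFun hη p
  · exact congrFun hξ p
  · fin_cases p
    exact hz

/-- The structure of a family of pairs of functionals degenerating to the tuple `famTuple b c T`. -/
structure DegenerationData (b : Fin n → Fin r → K) (c : Fin n → Fin n → K)
    (T : Fin r → Fin r → Fin r → K) (R : Type*) [CommRing R] [Algebra K R] where
  /-- leading functional -/
  L₀ : R →ₗ[K] K
  /-- first order functional -/
  L₁ : R →ₗ[K] K
  /-- leading terms of the generators -/
  x₀ : Fin n → R
  /-- first order terms of the generators -/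
  x₁ : Fin n → R
  /-- elements dual to the generators -/
  y : Fin r → R
  /-- the socle element -/
  z : R
  L₀_one : L₀ 1 = 0
  L₁_one : L₁ 1 = 0
  L₀_x₀ : ∀ i, L₀ (x₀ i) = 0
  L₀_x₁ : ∀ i, L₀ (x₁ i) + L₁ (x₀ i) = 0
  L₀_y : ∀ a, L₀ (y a) = 0
  L₁_y : ∀ a, L₁ (y a) = 0
  L₀_z : L₀ z = 1
  L₀_xy : ∀ i a, L₀ (x₀ i * y a) = b i a
  L₀_xx : ∀ i j, L₀ (x₀ i * x₀ j) = 0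
  L₁_xx : ∀ i j, L₀ (x₀ i * x₁ j) + L₀ (x₁ i * x₀ j) + L₁ (x₀ i * x₀ j) = c i j
  L₀_xxx : ∀ i j k, L₀ (x₀ i * x₀ j * x₀ k) = ∑ a, ∑ e, ∑ f, T a e f * b i a * b j e * b k f

lemma CubicLimit.zero_of_eq {F : K → K} {g : K → K} (hg : PolyFun g)
    (h : ∀ t, t ^ 4 * g t = F t) : CubicLimit F 0 :=
  ⟨fun t => t * g t, PolyFun.id.mul hg, fun t => by rw [← h]; ring, by simp⟩

namespace DegenerationData

variable {b : Fin n → Fin r → K} {c : Fin n → Fin n → K} {T : Fin r → Fin r → Fin r → K}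
  (S : DegenerationData b c T R)

/-- The moving frame. -/
abbrev frame (t : K) := scaledFrame S.x₀ S.x₁ S.y S.z t

lemma frame_x (t : K) (i : Fin n) :
    S.frame t (Sum.inr (Sum.inr (Sum.inl i))) = t • (S.x₀ i + t • S.x₁ i) := by
  simp only [frame, scaledFrame, smul_add, smul_smul, sq]

lemma frame_z (t : K) (j : Fin 1) : S.frame t (Sum.inl j) = t ^ 3 • S.z := rfl

lemma frame_y (t : K) (a : Fin r) : S.frame t (Sum.inr (Sum.inl a)) = t ^ 2 • S.y a := rfl

lemma frame_one (t : K) (j : Fin 1) : S.frame t (Sum.inr (Sum.inr (Sum.inr j))) = 1 := rfl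

lemma gram_limit (p q : Fin 1 ⊕ (Fin r ⊕ (Fin n ⊕ Fin 1))) :
    CubicLimit (fun t => pencil S.L₀ S.L₁ t (S.frame t p * S.frame t q))
      (limitGram b c (fun i => S.L₁ (S.x₁ i)) p q) := by
  have hzz : CubicLimit (fun t => pencil S.L₀ S.L₁ t (t ^ 3 • S.z * t ^ 3 • S.z)) 0 :=
    CubicLimit.zero_of_eq (g := fun t => t ^ 2 * pencil S.L₀ S.L₁ t (S.z * S.z)) (by fun_prop)
      fun t => by simp; ring
  have hzy : ∀ a, CubicLimit (fun t => pencil S.L₀ S.L₁ t (t ^ 3 • S.z * t ^ 2 • S.y a)) 0 :=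
    fun a => CubicLimit.zero_of_eq (g := fun t => t * pencil S.L₀ S.L₁ t (S.z * S.y a))
      (by fun_prop) fun t => by simp; ring
  have hzx : ∀ i, CubicLimit (fun t => pencil S.L₀ S.L₁ t
      (t ^ 3 • S.z * t • (S.x₀ i + t • S.x₁ i))) 0 :=
    fun i => CubicLimit.zero_of_eq (g := fun t => pencil S.L₀ S.L₁ t (S.z * S.x₀ i) +
      t * pencil S.L₀ S.L₁ t (S.z * S.x₁ i)) (by fun_prop) fun t => by simp [mul_add]; ring
  have hz1 : CubicLimit (fun t => pencil S.L₀ S.L₁ t (t ^ 3 • S.z)) 1 :=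
    ⟨fun t => pencil S.L₀ S.L₁ t S.z, by fun_prop, fun t => by simp,
      by simp [pencil, S.L₀_z]⟩
  have hyy : ∀ a a', CubicLimit (fun t => pencil S.L₀ S.L₁ t
      (t ^ 2 • S.y a * t ^ 2 • S.y a')) 0 :=
    fun a a' => CubicLimit.zero_of_eq (g := fun t => pencil S.L₀ S.L₁ t (S.y a * S.y a'))
      (by fun_prop) fun t => by simp; ring
  have hyx : ∀ a i, CubicLimit (fun t => pencil S.L₀ S.L₁ t
      (t ^ 2 • S.y a * t • (S.x₀ i + t • S.x₁ i))) (b i a) :=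
    fun a i => ⟨fun t => pencil S.L₀ S.L₁ t (S.y a * S.x₀ i) +
      t * pencil S.L₀ S.L₁ t (S.y a * S.x₁ i), by fun_prop, fun t => by simp [mul_add]; ring,
      by simp [pencil, mul_comm (S.y a), S.L₀_xy]⟩
  have hy1 : ∀ a, CubicLimit (fun t => pencil S.L₀ S.L₁ t (t ^ 2 • S.y a)) 0 :=
    fun a => ⟨fun _ => 0, by fun_prop, fun t => by simp [pencil, S.L₀_y, S.L₁_y], rfl⟩
  have hxx : ∀ i j, CubicLimit (fun t => pencil S.L₀ S.L₁ t
      (t • (S.x₀ i + t • S.x₁ i) * t • (S.x₀ j + t • S.x₁ j))) (c i j) :=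
    fun i j => ⟨fun t => c i j + t * (S.L₀ (S.x₁ i * S.x₁ j) + S.L₁ (S.x₀ i * S.x₁ j) +
      S.L₁ (S.x₁ i * S.x₀ j)) + t ^ 2 * S.L₁ (S.x₁ i * S.x₁ j), by fun_prop,
      fun t => by simp [pencil, mul_add, add_mul, ← S.L₁_xx, S.L₀_xx]; ring, by simp⟩
  have hx1 : ∀ i, CubicLimit (fun t => pencil S.L₀ S.L₁ t
      (t • (S.x₀ i + t • S.x₁ i))) (S.L₁ (S.x₁ i)) :=
    fun i => ⟨fun t => S.L₁ (S.x₁ i), by fun_prop, fun t => by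
      simp [pencil, S.L₀_x₀, eq_neg_of_add_eq_zero_left (S.L₀_x₁ i)]; ring, rfl⟩
  have h11 : CubicLimit (fun t => pencil S.L₀ S.L₁ t 1) 0 :=
    ⟨fun _ => 0, by fun_prop, fun t => by simp [pencil, S.L₀_one, S.L₁_one], rfl⟩
  rcases p with p | p | p | p <;> rcases q with q | q | q | q
  · simpa only [limitGram, Matrix.of_apply, frame_z, frame_y, frame_x, frame_one, mul_one,
      one_mul] using hzz
  · simpa only [limitGram, Matrix.of_apply, frame_z, frame_y, frame_x, frame_one, mul_one,
      one_mul] using hzy q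
  · simpa only [limitGram, Matrix.of_apply, frame_z, frame_y, frame_x, frame_one, mul_one,
      one_mul] using hzx q
  · simpa only [limitGram, Matrix.of_apply, frame_z, frame_y, frame_x, frame_one, mul_one,
      one_mul] using hz1
  · simpa only [limitGram, Matrix.of_apply, frame_z, frame_y, frame_x, frame_one, mul_one,
      one_mul, mul_comm] using hzy p
  · simpa only [limitGram, Matrix.of_apply, frame_z, frame_y, frame_x, frame_one, mul_one,
      one_mul] using hyy p q
  · simpa only [limitGram, Matrix.of_apply, frame_z, frame_y, frame_x, frame_one, mul_one,
      one_mul] using hyx p q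
  · simpa only [limitGram, Matrix.of_apply, frame_z, frame_y, frame_x, frame_one, mul_one,
      one_mul] using hy1 p
  · simpa only [limitGram, Matrix.of_apply, frame_z, frame_y, frame_x, frame_one, mul_one,
      one_mul, mul_comm] using hzx p
  · simpa only [limitGram, Matrix.of_apply, frame_z, frame_y, frame_x, frame_one, mul_one,
      one_mul, mul_comm] using hyx q p
  · simpa only [limitGram, Matrix.of_apply, frame_z, frame_y, frame_x, frame_one, mul_one,
      one_mul] using hxx p q
  · simpa only [limitGram, Matrix.of_apply, frame_z, frame_y, frame_x, frame_one, mul_one,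
      one_mul] using hx1 p
  · simpa only [limitGram, Matrix.of_apply, frame_z, frame_y, frame_x, frame_one, mul_one,
      one_mul] using hz1
  · simpa only [limitGram, Matrix.of_apply, frame_z, frame_y, frame_x, frame_one, mul_one,
      one_mul] using hy1 q
  · simpa only [limitGram, Matrix.of_apply, frame_z, frame_y, frame_x, frame_one, mul_one,
      one_mul] using hx1 q
  · simpa only [limitGram, Matrix.of_apply, frame_z, frame_y, frame_x, frame_one, mul_one,
      one_mul] using h11

lemma limitGram_mul_famTuple (κ : Fin n → K) (i : Fin n)
    (p q : Fin 1 ⊕ (Fin r ⊕ (Fin n ⊕ Fin 1))) :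
    (limitGram b c κ * famTuple b c T i) p q =
      match p, q with
      | Sum.inr (Sum.inr (Sum.inl j)), Sum.inr (Sum.inr (Sum.inl k)) =>
        ∑ a, ∑ e, ∑ f, T a e f * b j a * b i e * b k f
      | p, Sum.inr (Sum.inr (Sum.inr _)) => limitGram b c κ p (Sum.inr (Sum.inr (Sum.inl i)))
      | Sum.inr (Sum.inr (Sum.inr _)), Sum.inr (Sum.inl a) => b i a
      | Sum.inr (Sum.inr (Sum.inr _)), Sum.inr (Sum.inr (Sum.inl j)) => c i j
      | _, _ => 0 := by
  rcases p with p | p | p | p <;> rcases q with q | q | q | q <;>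
    simp [Matrix.mul_apply, limitGram, famTuple, blockMat1rn1, Pi.single_apply, Finset.mul_sum]
  refine Finset.sum_congr rfl fun a _ => Finset.sum_congr rfl fun e _ =>
    Finset.sum_congr rfl fun f _ => by ring

lemma frame_polyFun (v : R) (q : Fin 1 ⊕ (Fin r ⊕ (Fin n ⊕ Fin 1))) :
    PolyFun fun t => pencil S.L₀ S.L₁ t (v * S.frame t q) := by
  rcases q with q | q | q | q <;>
    simp only [frame_z, frame_y, frame_x, frame_one, mul_smul_comm, mul_add, map_add, map_smul,
      smul_eq_mul] <;> fun_prop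

lemma mul_limit (i : Fin n) (p q : Fin 1 ⊕ (Fin r ⊕ (Fin n ⊕ Fin 1))) :
    CubicLimit (fun t => pencil S.L₀ S.L₁ t
        (S.frame t (Sum.inr (Sum.inr (Sum.inl i))) * (S.frame t p * S.frame t q)))
      ((limitGram b c (fun i => S.L₁ (S.x₁ i)) * famTuple b c T i) p q) := by
  have hz : ∀ j q, CubicLimit (fun t => pencil S.L₀ S.L₁ t
      (S.frame t (Sum.inr (Sum.inr (Sum.inl i))) * (S.frame t (Sum.inl j) * S.frame t q))) 0 := by
    intro j q
    refine CubicLimit.zero_of_eq (g := fun t => pencil S.L₀ S.L₁ t (S.x₀ i * S.z * S.frame t q) +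
      t * pencil S.L₀ S.L₁ t (S.x₁ i * S.z * S.frame t q)) ?_ fun t => ?_
    · exact (S.frame_polyFun _ q).add (PolyFun.id.mul (S.frame_polyFun _ q))
    · simp [frame_x, frame_z, add_mul, mul_assoc]
      ring
  have hyy : ∀ a a', CubicLimit (fun t => pencil S.L₀ S.L₁ t
      (t • (S.x₀ i + t • S.x₁ i) * (t ^ 2 • S.y a * t ^ 2 • S.y a'))) 0 := by
    refine fun a a' => CubicLimit.zero_of_eq (g := fun t => t * pencil S.L₀ S.L₁ t
      (S.x₀ i * (S.y a * S.y a')) + t ^ 2 * pencil S.L₀ S.L₁ t (S.x₁ i * (S.y a * S.y a')))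
      (by fun_prop) fun t => ?_
    simp [add_mul]
    ring
  have hyx : ∀ a j, CubicLimit (fun t => pencil S.L₀ S.L₁ t
      (t • (S.x₀ i + t • S.x₁ i) * (t ^ 2 • S.y a * t • (S.x₀ j + t • S.x₁ j)))) 0 := by
    refine fun a j => CubicLimit.zero_of_eq (g := fun t => pencil S.L₀ S.L₁ t
      (S.x₀ i * (S.y a * S.x₀ j)) + t * pencil S.L₀ S.L₁ t (S.x₁ i * (S.y a * S.x₀ j)) +
      t * pencil S.L₀ S.L₁ t (S.x₀ i * (S.y a * S.x₁ j)) +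
      t ^ 2 * pencil S.L₀ S.L₁ t (S.x₁ i * (S.y a * S.x₁ j))) (by fun_prop) fun t => ?_
    simp [add_mul, mul_add]
    ring
  have hxx : ∀ j k, CubicLimit (fun t => pencil S.L₀ S.L₁ t
      (t • (S.x₀ i + t • S.x₁ i) * (t • (S.x₀ j + t • S.x₁ j) * t • (S.x₀ k + t • S.x₁ k))))
      (∑ a, ∑ e, ∑ f, T a e f * b j a * b i e * b k f) := by
    refine fun j k => ⟨fun t => pencil S.L₀ S.L₁ t (S.x₀ i * (S.x₀ j * S.x₀ k)) +
      t * (pencil S.L₀ S.L₁ t (S.x₁ i * (S.x₀ j * S.x₀ k)) +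
        pencil S.L₀ S.L₁ t (S.x₀ i * (S.x₁ j * S.x₀ k)) +
        pencil S.L₀ S.L₁ t (S.x₀ i * (S.x₀ j * S.x₁ k))) +
      t ^ 2 * (pencil S.L₀ S.L₁ t (S.x₁ i * (S.x₁ j * S.x₀ k)) +
        pencil S.L₀ S.L₁ t (S.x₁ i * (S.x₀ j * S.x₁ k)) +
        pencil S.L₀ S.L₁ t (S.x₀ i * (S.x₁ j * S.x₁ k))) +
      t ^ 3 * pencil S.L₀ S.L₁ t (S.x₁ i * (S.x₁ j * S.x₁ k)), by fun_prop, fun t => ?_, ?_⟩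
    · simp [add_mul, mul_add]
      ring
    · rw [← S.L₀_xxx j i k]
      simp only [pencil, zero_smul, add_zero, zero_mul, ne_eq, OfNat.ofNat_ne_zero,
        not_false_eq_true, zero_pow]
      congr 1
      ring
  rw [limitGram_mul_famTuple]
  rcases q with q | q | q | q
  · have h := hz q p
    simp only [mul_comm (S.frame _ (Sum.inl q))] at h
    rcases p with p | p | p | p <;> exact h
  · rcases p with p | p | p | p
    · exact hz p _
    · simpa only [frame_x, frame_y] using hyy p q
    · have h := hyx q p
      simp only [mul_comm (_ ^ 2 • S.y q)] at h
      simpa only [frame_x, frame_y] using h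
    · simpa only [frame_one, one_mul, limitGram, Matrix.of_apply] using
        S.gram_limit (Sum.inr (Sum.inr (Sum.inl i))) (Sum.inr (Sum.inl q))
  · rcases p with p | p | p | p
    · exact hz p _
    · simpa only [frame_x, frame_y] using hyx p q
    · simpa only [frame_x] using hxx p q
    · simpa only [frame_one, one_mul, limitGram, Matrix.of_apply] using
        S.gram_limit (Sum.inr (Sum.inr (Sum.inl i))) (Sum.inr (Sum.inr (Sum.inl q)))
  · have h := S.gram_limit p (Sum.inr (Sum.inr (Sum.inl i)))
    simp only [mul_comm (S.frame _ p)] at h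
    rcases p with p | p | p | p <;> simpa only [frame_one, mul_one] using h

/-- The tuple `famTuple b c T` is a limit of tuples of multiplication operators on `R`. -/
theorem inSimDiagClosure [Infinite K] (S : DegenerationData b c T R)
    (hcard : Fintype.card (Fin 1 ⊕ (Fin r ⊕ (Fin n ⊕ Fin 1))) = Module.finrank K R)
    (hR : ∀ (β : Module.Basis (Fin 1 ⊕ (Fin r ⊕ (Fin n ⊕ Fin 1))) K R) (x : Fin n → R),
      InSimDiagClosure fun i => Algebra.leftMulMatrix β (x i))
    (hbc : ∀ (ξ : Fin n → K) (η : Fin r → K), (∀ a, ∑ i, b i a * ξ i = 0) →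
      (∀ i, ∑ a, b i a * η a + ∑ j, c i j * ξ j = 0) → ξ = 0 ∧ η = 0) :
    InSimDiagClosure (famTuple b c T) := by
  choose G hGpoly hG hG0 using S.gram_limit
  choose M hMpoly hM hM0 using S.mul_limit
  refine InSimDiagClosure.of_gram_limit (G := fun t => Matrix.of fun p q => G p q t)
    (M := fun t i => Matrix.of fun p q => M i p q t) hGpoly hMpoly (fun t ht hdet => ?_) ?_ ?_
  · have hli : LinearIndependent K (S.frame t) := by
      rw [Fintype.linearIndependent_iff]
      intro g hg
      have hmul : (Matrix.of fun p q => G p q t) *ᵥ g = 0 := by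
        funext p
        have hp : t ^ 3 * ∑ q, G p q t * g q = 0 := by
          calc t ^ 3 * ∑ q, G p q t * g q
              = pencil S.L₀ S.L₁ t (S.frame t p * ∑ q, g q • S.frame t q) := by
                simp only [Finset.mul_sum, map_sum, mul_smul_comm, map_smul, smul_eq_mul, ← hG]
                exact Finset.sum_congr rfl fun q _ => by ring
            _ = 0 := by rw [hg, mul_zero, map_zero]
        exact (mul_eq_zero.1 hp).resolve_left (pow_ne_zero 3 ht)
      exact congrFun (Matrix.eq_zero_of_mulVec_eq_zero hdet hmul)
    let β := basisOfLinearIndependentOfCardEqFinrank hli hcard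
    have hβ : ∀ q, β q = S.frame t q := fun q => by simp [β]
    refine ⟨_, hR β fun i => S.frame t (Sum.inr (Sum.inr (Sum.inl i))), fun i => ?_⟩
    ext p q
    refine mul_left_cancel₀ (pow_ne_zero 3 ht) ?_
    have hsum : ∑ s, Algebra.leftMulMatrix β (S.frame t (Sum.inr (Sum.inr (Sum.inl i)))) s q •
        S.frame t s = S.frame t (Sum.inr (Sum.inr (Sum.inl i))) * S.frame t q := by
      simp only [Algebra.leftMulMatrix_eq_repr_mul, ← hβ]
      exact β.sum_repr _
    calc t ^ 3 * ∑ s, G p s t *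
          Algebra.leftMulMatrix β (S.frame t (Sum.inr (Sum.inr (Sum.inl i)))) s q
        = pencil S.L₀ S.L₁ t (S.frame t p * ∑ s, Algebra.leftMulMatrix β
            (S.frame t (Sum.inr (Sum.inr (Sum.inl i)))) s q • S.frame t s) := by
          simp only [Finset.mul_sum, map_sum, mul_smul_comm, map_smul, smul_eq_mul, ← hG]
          exact Finset.sum_congr rfl fun s _ => by ring
      _ = t ^ 3 * M i p q t := by rw [hsum, hM, mul_left_comm]
  · rw [show (Matrix.of fun p q => G p q 0) = limitGram b c (fun i => S.L₁ (S.x₁ i)) from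
      Matrix.ext hG0]
    exact limitGram_det_ne_zero _ hbc
  · intro i
    rw [show (Matrix.of fun p q => G p q 0) = limitGram b c (fun i => S.L₁ (S.x₁ i)) from
      Matrix.ext hG0]
    exact (Matrix.ext (hM0 i)).symm

end DegenerationData

end Degeneration

section Points

variable {K : Type*} [Field K]

lemma sum_mul_dotProduct {ι r : Type*} [Fintype ι] [Fintype r] (F : ι → K) (u : ι → r → K)
    (v : r → K) : ∑ k, F k * (v ⬝ᵥ u k) = ∑ a, v a * ∑ k, F k * u k a := by
  simp only [dotProduct, Finset.mul_sum]
  rw [Finset.sum_comm]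
  exact Finset.sum_congr rfl fun _ _ => Finset.sum_congr rfl fun _ _ => by ring

lemma sum_mul_dotProduct_sq {ι r : Type*} [Fintype ι] [Fintype r] (μ : ι → K) (u : ι → r → K)
    (v w : r → K) : ∑ k, μ k * (w ⬝ᵥ u k) * (v ⬝ᵥ u k) =
      ∑ a, v a * ∑ e, w e * ∑ k, μ k * u k a * u k e := by
  rw [sum_mul_dotProduct]
  refine Finset.sum_congr rfl fun a _ => ?_
  rw [← sum_mul_dotProduct]
  simp only [mul_right_comm]

lemma sum_mul_dotProduct_cube {ι r : Type*} [Fintype ι] [Fintype r] (μ : ι → K) (u : ι → r → K)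
    (v w x : r → K) : ∑ k, μ k * (x ⬝ᵥ u k) * (w ⬝ᵥ u k) * (v ⬝ᵥ u k) =
      ∑ a, v a * ∑ e, w e * ∑ f, x f * ∑ k, μ k * u k a * u k e * u k f := by
  rw [sum_mul_dotProduct]
  refine Finset.sum_congr rfl fun a _ => ?_
  rw [← sum_mul_dotProduct_sq]
  congr 1
  exact Finset.sum_congr rfl fun k _ => by ring

lemma sum_mul_dotProduct_dual {ι r : Type*} [Fintype ι] [Fintype r] [DecidableEq r] {μ : ι → K}
    {u : ι → r → K} {h : r → ι → K}
    (hh : ∀ a e, ∑ k, μ k * h a k * u k e = if a = e then 1 else 0) (v : r → K) (a : r) :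
    ∑ k, μ k * ((v ⬝ᵥ u k) * h a k) = v a := by
  have h1 := sum_mul_dotProduct (fun k => μ k * h a k) u v
  simp only [hh, mul_ite, mul_one, mul_zero, Finset.sum_ite_eq, Finset.mem_univ, if_true] at h1
  rw [← h1]
  exact Finset.sum_congr rfl fun _ _ => by ring

/-- The functional used on the reduced points and the fat point. -/
def pointFunctional {κ : Type*} [Fintype κ] (μ : κ → K) (s e : K) :
    (κ → K) × DualNumber K →ₗ[K] K where
  toFun v := ∑ k, μ k * v.1 k + s * v.2.fst + e * v.2.snd
  map_add' v w := by simp [mul_add, Finset.sum_add_distrib]; ring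
  map_smul' a v := by
    simp only [Prod.smul_fst, Pi.smul_apply, smul_eq_mul, Prod.smul_snd, TrivSqZeroExt.fst_smul,
      TrivSqZeroExt.snd_smul, RingHom.id_apply, mul_add, Finset.mul_sum]
    congr 1
    · congr 1
      · exact Finset.sum_congr rfl fun _ _ => by ring
      · ring
    · ring

lemma pointFunctional_apply {κ : Type*} [Fintype κ] (μ : κ → K) (s e : K)
    (v : (κ → K) × DualNumber K) :
    pointFunctional μ s e v = ∑ k, μ k * v.1 k + s * v.2.fst + e * v.2.snd := rfl

variable {r n m : ℕ}

/-- Degeneration data coming from `2 r + m` reduced points and a fat point of length two. -/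
def pointData {b : Fin n → Fin r → K} {c : Fin n → Fin n → K} {T : Fin r → Fin r → Fin r → K}
    {γ : Fin n → Fin m → K} {w : Fin m → K} {q : Fin n → Fin r → K}
    (hc : ∀ i j, c i j = ∑ a, (b i a * q j a + q i a * b j a) + ∑ k, w k * γ i k * γ j k)
    (u u' h : Fin r → Fin r → K) (μ μ' : Fin r → K)
    (hu : ∀ a e, ∑ k, μ k * u k a * u k e = ∑ k, μ' k * u' k a * u' k e)
    (hT : ∀ a e f, T a e f =
      ∑ k, μ k * u k a * u k e * u k f - ∑ k, μ' k * u' k a * u' k e * u' k f)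
    (hh : ∀ a e, ∑ k, μ k * h a k * u k e = if a = e then 1 else 0) :
    DegenerationData b c T ((Fin r ⊕ (Fin r ⊕ Fin m) → K) × DualNumber K) where
  L₀ := pointFunctional (Sum.elim μ (Sum.elim (-μ') 0)) (∑ k, μ' k - ∑ k, μ k) 1
  L₁ := pointFunctional (Sum.elim 0 (Sum.elim 0 w)) (-∑ k, w k) 0
  x₀ i := (Sum.elim (fun k => b i ⬝ᵥ u k) (Sum.elim (fun k => b i ⬝ᵥ u' k) (γ i)),
    TrivSqZeroExt.inr (∑ k, μ' k * (b i ⬝ᵥ u' k) - ∑ k, μ k * (b i ⬝ᵥ u k)))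
  x₁ i := (Sum.elim (fun k => q i ⬝ᵥ fun a => h a k) 0,
    TrivSqZeroExt.inr (-∑ k, μ k * (q i ⬝ᵥ fun a => h a k) - ∑ k, w k * γ i k))
  y a := (Sum.elim (h a) 0, TrivSqZeroExt.inr (-∑ k, μ k * h a k))
  z := (0, TrivSqZeroExt.inr 1)
  L₀_one := by
    simp [pointFunctional_apply]
    ring
  L₁_one := by
    simp [pointFunctional_apply]
  L₀_x₀ i := by
    simp [pointFunctional_apply]
    ring
  L₀_x₁ i := by
    simp [pointFunctional_apply]
    ring
  L₀_y a := by
    simp [pointFunctional_apply]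
  L₁_y a := by
    simp [pointFunctional_apply]
  L₀_z := by
    simp [pointFunctional_apply]
  L₀_xy i a := by
    simp [pointFunctional_apply, sum_mul_dotProduct_dual hh]
  L₀_xx i j := by
    have h1 := sum_mul_dotProduct_sq μ u (b j) (b i)
    simp only [hu, ← sum_mul_dotProduct_sq] at h1
    simp [pointFunctional_apply, ← mul_assoc, h1]
  L₁_xx i j := by
    have h1 : ∀ i j, ∑ k, μ k * ((b i ⬝ᵥ u k) * (q j ⬝ᵥ fun a => h a k)) =
        ∑ a, b i a * q j a := by
      intro i j
      have h2 := sum_mul_dotProduct (fun k => μ k * (b i ⬝ᵥ u k)) (fun k a => h a k) (q j)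
      simp only [sum_mul_dotProduct_dual hh, mul_assoc] at h2
      rw [h2]
      exact Finset.sum_congr rfl fun _ _ => mul_comm _ _
    have h2 : ∑ k, μ k * ((q i ⬝ᵥ fun a => h a k) * (b j ⬝ᵥ u k)) = ∑ a, q i a * b j a := by
      simpa only [mul_comm (q i ⬝ᵥ _), mul_comm (q i _)] using h1 j i
    simp [pointFunctional_apply, h1, h2, hc, mul_assoc, Finset.sum_add_distrib]
  L₀_xxx i j k := by
    have h1 := sum_mul_dotProduct_cube μ u (b i) (b j) (b k)
    have h2 := sum_mul_dotProduct_cube μ' u' (b i) (b j) (b k)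
    have h3 : ∑ a, ∑ e, ∑ f, T a e f * b i a * b j e * b k f =
        ∑ l, μ l * (b k ⬝ᵥ u l) * (b j ⬝ᵥ u l) * (b i ⬝ᵥ u l) -
          ∑ l, μ' l * (b k ⬝ᵥ u' l) * (b j ⬝ᵥ u' l) * (b i ⬝ᵥ u' l) := by
      simp only [h1, h2, hT, ← Finset.sum_sub_distrib, ← mul_sub, Finset.mul_sum]
      refine Finset.sum_congr rfl fun a _ => Finset.sum_congr rfl fun e _ =>
        Finset.sum_congr rfl fun f _ => ?_
      simp only [Finset.sum_mul]
      exact Finset.sum_congr rfl fun l _ => by ring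
    rw [h3]
    simp only [pointFunctional_apply, Fintype.sum_sum_type]
    simp [sub_eq_add_neg]
    congr 1
    · exact Finset.sum_congr rfl fun l _ => by ring
    · exact congrArg Neg.neg (Finset.sum_congr rfl fun l _ => by ring)

/-- Tensors which are differences of weighted sums of cubes with equal quadratic moments. -/
lemma inSimDiagClosure_of_points [Infinite K] (hn : n = r + m)
    {b : Fin n → Fin r → K} {c : Fin n → Fin n → K} {T : Fin r → Fin r → Fin r → K}
    {γ : Fin n → Fin m → K} {w : Fin m → K} {q : Fin n → Fin r → K} (hw : ∀ k, w k ≠ 0)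
    (hc : ∀ i j, c i j = ∑ a, (b i a * q j a + q i a * b j a) + ∑ k, w k * γ i k * γ j k)
    (hinj : ∀ ξ : Fin n → K, (∀ a, ∑ i, b i a * ξ i = 0) → (∀ k, ∑ i, γ i k * ξ i = 0) → ξ = 0)
    (u u' h : Fin r → Fin r → K) (μ μ' : Fin r → K)
    (hu : ∀ a e, ∑ k, μ k * u k a * u k e = ∑ k, μ' k * u' k a * u' k e)
    (hT : ∀ a e f, T a e f =
      ∑ k, μ k * u k a * u k e * u k f - ∑ k, μ' k * u' k a * u' k e * u' k f)
    (hh : ∀ a e, ∑ k, μ k * h a k * u k e = if a = e then 1 else 0) :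
    InSimDiagClosure (famTuple b c T) := by
  refine (pointData hc u u' h μ μ' hu hT hh).inSimDiagClosure ?_
    inSimDiagClosure_leftMulMatrix ?_
  · have : Module.finrank K (DualNumber K) = 2 := by
      rw [Module.finrank_eq_card_basis (dualNumberBasis (1 : K) one_ne_zero), Fintype.card_fin]
    have : Module.Finite K (DualNumber K) :=
      Module.Finite.of_basis (dualNumberBasis (1 : K) one_ne_zero)
    simp [Module.finrank_prod, *]
    omega
  · intro ξ η h1 h2
    let M : (Fin n → K) →ₗ[K] (Fin r ⊕ Fin m → K) :=
      LinearMap.pi (Sum.elim (fun a => ∑ i, b i a • LinearMap.proj i)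
        (fun k => ∑ i, γ i k • LinearMap.proj i))
    have hM₁ : ∀ ξ a, M ξ (Sum.inl a) = ∑ i, b i a * ξ i := fun ξ a => by simp [M]
    have hM₂ : ∀ ξ k, M ξ (Sum.inr k) = ∑ i, γ i k * ξ i := fun ξ k => by simp [M]
    have hMinj : Function.Injective M := by
      rw [injective_iff_map_eq_zero]
      intro ξ hξ
      exact hinj ξ (fun a => by rw [← hM₁, hξ]; rfl) (fun k => by rw [← hM₂, hξ]; rfl)
    have hMsurj : Function.Surjective M :=
      (LinearMap.injective_iff_surjective_of_finrank_eq_finrank (by simp [hn])).1 hMinj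
    have hcol : ∀ v : Fin r ⊕ Fin m → K, (∀ i, ∑ a, b i a * v (Sum.inl a) +
        ∑ k, γ i k * v (Sum.inr k) = 0) → v = 0 := by
      intro v hv
      have hdot : ∀ ζ, M ζ ⬝ᵥ v = 0 := by
        intro ζ
        calc M ζ ⬝ᵥ v = ∑ i, ζ i * (∑ a, b i a * v (Sum.inl a) + ∑ k, γ i k * v (Sum.inr k)) := by
              simp only [dotProduct, Fintype.sum_sum_type, hM₁, hM₂, mul_add,
                Finset.sum_add_distrib, Finset.mul_sum, Finset.sum_mul]
              rw [Finset.sum_comm, Finset.sum_comm (s := (Finset.univ : Finset (Fin m)))]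
              congr 1 <;> exact Finset.sum_congr rfl fun _ _ => Finset.sum_congr rfl fun _ _ => by
                ring
          _ = 0 := by simp [hv]
      funext s
      obtain ⟨ζ, hζ⟩ := hMsurj (Pi.single s 1)
      simpa [hζ] using hdot ζ
    have hv := hcol (Sum.elim (fun a => η a + ∑ j, q j a * ξ j)
      (fun k => w k * ∑ j, γ j k * ξ j)) fun i => by
        rw [← h2 i]
        simp only [Sum.elim_inl, Sum.elim_inr, hc]
        have e1 : ∀ j, (∑ a, (b i a * q j a + q i a * b j a) + ∑ k, w k * γ i k * γ j k) * ξ j =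
            ∑ a, b i a * (q j a * ξ j) + ∑ a, q i a * (b j a * ξ j) +
              ∑ k, γ i k * (w k * (γ j k * ξ j)) := by
          intro j
          simp only [add_mul, Finset.sum_mul, Finset.sum_add_distrib]
          congr 1
          · congr 1 <;> exact Finset.sum_congr rfl fun _ _ => by ring
          · exact Finset.sum_congr rfl fun _ _ => by ring
        have e2 : ∑ j, ∑ a, q i a * (b j a * ξ j) = 0 := by
          rw [Finset.sum_comm]
          simp only [← Finset.mul_sum, h1, mul_zero, Finset.sum_const_zero]
        simp only [e1]
        simp only [Finset.sum_add_distrib, e2, add_zero, mul_add, Finset.mul_sum]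
        rw [Finset.sum_comm (s := (Finset.univ : Finset (Fin n))),
          Finset.sum_comm (s := (Finset.univ : Finset (Fin n)))]
        ring
    have hξ : ξ = 0 := hinj ξ h1 fun k => by
      have := congrFun hv (Sum.inr k)
      exact (mul_eq_zero.1 this).resolve_left (hw k)
    refine ⟨hξ, funext fun a => ?_⟩
    simpa [hξ] using congrFun hv (Sum.inl a)

end Points

section Quadratic

variable {K : Type*} [Field K] {r n m : ℕ}

/-- The closure is stable along polynomial curves, where finitely many parameters may be ignored. -/
lemma InSimDiagClosure.of_curve_cofinite [Infinite K] {N ι : Type*} [Fintype ι] [DecidableEq ι]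
    {A : K → N → Matrix ι ι K} (hA : ∀ i p q, PolyFun fun t => A t i p q) (s : Finset K)
    (h : ∀ t ∉ s, InSimDiagClosure (A t)) (t : K) : InSimDiagClosure (A t) := by
  obtain ⟨t₀, ht₀⟩ := Infinite.exists_notMem_finset s
  have hne : ∀ x, ∏ a ∈ s, (x - a) ≠ 0 ↔ x ∉ s := by
    intro x
    rw [Finset.prod_ne_zero_iff]
    exact ⟨fun hx hxs => hx x hxs (sub_self x), fun hx a ha => sub_ne_zero.2 fun h => hx (h ▸ ha)⟩
  exact InSimDiagClosure.of_curve (θ := fun x => ∏ a ∈ s, (x - a)) hA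
    (PolyFun.finsetProd _ fun a => by fun_prop) ((hne t₀).2 ht₀) (fun x hx => h x ((hne x).1 hx)) t

lemma famTuple_polyFun {b : Fin n → Fin r → K} {c : K → Fin n → Fin n → K}
    {T : K → Fin r → Fin r → Fin r → K} (hc : ∀ i j, PolyFun fun t => c t i j)
    (hT : ∀ a e f, PolyFun fun t => T t a e f) (i : Fin n)
    (p q : Fin 1 ⊕ (Fin r ⊕ (Fin n ⊕ Fin 1))) : PolyFun fun t => famTuple b (c t) (T t) i p q := by
  have h0 : PolyFun fun _ : K => (0 : K) := PolyFun.const 0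
  rcases p with p | p | p | p <;> rcases q with q | q | q | q <;>
    simp only [famTuple, blockMat1rn1, Matrix.of_apply] <;> first | exact h0 | fun_prop

/-- The weighted sums of cubes of two families of points related by a quadratic identity. -/
lemma inSimDiagClosure_of_cubes [Infinite K] (hn : n = r + m)
    {b : Fin n → Fin r → K} {c : Fin n → Fin n → K}
    {γ : Fin n → Fin m → K} {w : Fin m → K} {q : Fin n → Fin r → K}
    (hc : ∀ i j, c i j = ∑ a, (b i a * q j a + q i a * b j a) + ∑ k, w k * γ i k * γ j k)
    (hinj : ∀ ξ : Fin n → K, (∀ a, ∑ i, b i a * ξ i = 0) → (∀ k, ∑ i, γ i k * ξ i = 0) → ξ = 0)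
    (p p' h : Matrix (Fin r) (Fin r) K) (d d' : Fin r → K) (hd : ∀ k, d k ≠ 0) (hd' : ∀ k, d' k ≠ 0)
    (hdd : ∀ a e, ∑ k, d k * p k a * p k e = ∑ k, d' k * p' k a * p' k e)
    (hh : h * p = 1) (σ σ' : Fin r → K) :
    InSimDiagClosure (famTuple b c fun a e f =>
      ∑ k, σ k * p k a * p k e * p k f + ∑ k, σ' k * p' k a * p' k e * p' k f) := by
  classical
  have hcurve := InSimDiagClosure.of_curve_cofinite (A := fun t => famTuple b
      (fun i j => c i j + t * ∑ k, γ i k * γ j k) fun a e f =>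
      ∑ k, (σ k + t) * p k a * p k e * p k f + ∑ k, (σ' k + t) * p' k a * p' k e * p' k f)
    (famTuple_polyFun (fun i j => by fun_prop) fun a e f => by fun_prop)
    (Finset.univ.image (fun k => -w k) ∪ Finset.univ.image (fun k => -σ k) ∪
      Finset.univ.image (fun k => -σ' k)) (fun t ht => ?_) 0
  · simpa using hcurve
  · simp only [Finset.mem_union, Finset.mem_image, Finset.mem_univ, true_and, not_or, not_exists,
      neg_eq_iff_add_eq_zero] at ht
    obtain ⟨⟨hw, hσ⟩, hσ'⟩ := ht
    refine inSimDiagClosure_of_points hn (w := fun k => w k + t) (γ := γ) (q := q) hw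
      (fun i j => ?_) hinj (fun k a => (σ k + t) / d k * p k a)
      (fun k a => -((σ' k + t) / d' k) * p' k a) (fun a k => (σ k + t) / d k ^ 2 * h a k)
      (fun k => d k ^ 3 / (σ k + t) ^ 2) (fun k => d' k ^ 3 / (σ' k + t) ^ 2)
      (fun a e => ?_) (fun a e f => ?_) (fun a e => ?_)
    · simp only [hc, add_assoc, Finset.mul_sum, add_mul, Finset.sum_add_distrib, mul_assoc]
    · refine Eq.trans ?_ ((hdd a e).trans ?_)
      · exact Finset.sum_congr rfl fun k _ => by
          have := hσ k
          have := hd k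
          field_simp
      · exact Finset.sum_congr rfl fun k _ => by
          have := hσ' k
          have := hd' k
          field_simp
    · rw [sub_eq_add_neg, ← Finset.sum_neg_distrib]
      congr 1
      · exact Finset.sum_congr rfl fun k _ => by
          have := hσ k
          have := hd k
          field_simp
      · exact Finset.sum_congr rfl fun k _ => by
          have := hσ' k
          have := hd' k
          field_simp
    · have := congrFun (congrFun hh a) e
      rw [Matrix.mul_apply, Matrix.one_apply] at this
      rw [← this]
      exact Finset.sum_congr rfl fun k _ => by
          have := hσ k
          have := hd k
          field_simp

lemma sum_mul_apply_single {ι : Type*} [Fintype ι] [DecidableEq ι] (f : (ι → K) →ₗ[K] K)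
    (x : ι → K) : ∑ a, x a * f (Pi.single a 1) = f x := by
  conv_rhs => rw [← Finset.univ_sum_single x, map_sum]
  refine Finset.sum_congr rfl fun a _ => ?_
  rw [← smul_eq_mul, ← map_smul, ← Pi.single_smul', smul_eq_mul, mul_one]

lemma exists_quadratic_decomposition [CharZero K] (hn : n = r + m) {b : Fin n → Fin r → K}
    (hb : Submodule.span K (Set.range b) = ⊤) {c : Fin n → Fin n → K} (hc : ∀ i j, c i j = c j i) :
    ∃ (γ : Fin n → Fin m → K) (w : Fin m → K) (q : Fin n → Fin r → K),
      (∀ i j, c i j = ∑ a, (b i a * q j a + q i a * b j a) + ∑ k, w k * γ i k * γ j k) ∧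
      ∀ ξ : Fin n → K, (∀ a, ∑ i, b i a * ξ i = 0) → (∀ k, ∑ i, γ i k * ξ i = 0) → ξ = 0 := by
  let bT : (Fin n → K) →ₗ[K] (Fin r → K) := Fintype.linearCombination K b
  have hbT : LinearMap.range bT = ⊤ := by rw [Fintype.range_linearCombination, hb]
  obtain ⟨s, hs⟩ := bT.exists_rightInverse_of_surjective hbT
  have hs' : ∀ v, bT (s v) = v := fun v => LinearMap.congr_fun hs v
  let W := LinearMap.ker bT
  have hW : Module.finrank K W = m := by
    have := bT.finrank_range_add_finrank_ker
    rw [hbT] at this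
    rw [finrank_top, Module.finrank_fin_fun, Module.finrank_fin_fun] at this
    change Module.finrank K (LinearMap.ker bT) = m
    omega
  let π : (Fin n → K) →ₗ[K] W := (LinearMap.id - s ∘ₗ bT).codRestrict W fun ξ => by
    simp [W, hs']
  have hπ : ∀ ξ, ξ = (π ξ : Fin n → K) + s (bT ξ) := fun ξ => by simp [π]
  let C : LinearMap.BilinForm K (Fin n → K) := Matrix.toBilin' (Matrix.of c)
  have hCc : ∀ i j, C (Pi.single i 1) (Pi.single j 1) = c i j := fun i j => by
    simp [C, Matrix.toBilin'_single]
  have hCsymm : ∀ x y, C x y = C y x := by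
    intro x y
    simp only [C, Matrix.toBilin'_apply, Matrix.of_apply]
    rw [Finset.sum_comm]
    exact Finset.sum_congr rfl fun i _ => Finset.sum_congr rfl fun j _ => by rw [hc]; ring
  have : Invertible (2 : K) := invertibleOfNonzero two_ne_zero
  obtain ⟨v, hv⟩ := LinearMap.BilinForm.exists_orthogonal_basis (B := C.restrict W)
    ⟨fun x y => hCsymm x y⟩
  let v' := v.reindex (finCongr hW)
  have hv' : ∀ k l, k ≠ l → C (v' k) (v' l) = 0 := by
    intro k l hkl
    simpa [v'] using hv (i := (finCongr hW).symm k) (j := (finCongr hW).symm l) (by simpa using hkl)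
  let γ : Fin n → Fin m → K := fun i k => v'.repr (π (Pi.single i 1)) k
  have hbTs : ∀ i, bT (Pi.single i 1) = b i := fun i => by simp [bT]
  let q : Fin n → Fin r → K := fun j a => C (s (Pi.single a 1)) (π (Pi.single j 1)) +
    2⁻¹ * C (s (Pi.single a 1)) (s (b j))
  have hq : ∀ i j, ∑ a, b i a * q j a = C (s (b i)) (π (Pi.single j 1)) +
      2⁻¹ * C (s (b i)) (s (b j)) := by
    intro i j
    have := sum_mul_apply_single
      ((C.flip (π (Pi.single j 1)) + (2⁻¹ : K) • C.flip (s (b j))) ∘ₗ s) (b i)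
    simpa [q] using this
  have hdiag : ∀ x y : W, C x y = ∑ k, C (v' k) (v' k) * v'.repr x k * v'.repr y k := by
    intro x y
    conv_lhs => rw [← v'.sum_repr x, ← v'.sum_repr y]
    simp only [Submodule.coe_sum, Submodule.coe_smul, map_sum, map_smul, LinearMap.sum_apply,
      LinearMap.smul_apply, smul_eq_mul]
    refine Finset.sum_congr rfl fun k _ => ?_
    rw [Finset.sum_eq_single k (fun l _ hl => by rw [hv' l k hl]; ring) (by simp)]
    ring
  have hsplit : ∀ x y, C x y = C (π x) (π y) + C (s (bT x)) (π y) + C (s (bT y)) (π x) +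
      C (s (bT x)) (s (bT y)) := by
    intro x y
    conv_lhs => rw [hπ x, hπ y]
    simp only [map_add, LinearMap.add_apply]
    rw [hCsymm (π x) (s (bT y))]
    ring
  refine ⟨γ, fun k => C (v' k) (v' k), q, fun i j => ?_, fun ξ h1 h2 => ?_⟩
  · simp only [Finset.sum_add_distrib, hq, mul_comm (q i _)]
    rw [← hCc, hsplit, hdiag, hbTs, hbTs, hCsymm (s (b j)) (s (b i))]
    ring
  · have hξ : bT ξ = 0 := by
      funext a
      simpa [bT, Fintype.linearCombination_apply, mul_comm] using h1 a
    have hrepr : ∀ k, v'.repr (π ξ) k = 0 := by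
      intro k
      rw [← h2 k]
      have := sum_mul_apply_single (v'.coord k ∘ₗ π) ξ
      simpa [γ, mul_comm] using this.symm
    have : π ξ = 0 := v'.ext_elem fun k => by simp [hrepr]
    rw [hπ ξ, this, hξ]
    simp

end Quadratic

section Points

variable {K : Type*} [Field K] {r n m s : ℕ}

/-- An orthogonal family of anisotropic vectors for a diagonal form extends to an orthogonal
basis. -/
lemma exists_orthogonal_extension [CharZero K] (ν : Fin r → K) (hν : ∀ i, ν i ≠ 0)
    (x : Fin s → Fin r → K) (hx : ∀ k l, k ≠ l → ∑ i, ν i * x k i * x l i = 0)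
    (hx' : ∀ k, ∑ i, ν i * x k i * x k i ≠ 0) :
    ∃ (q : Fin r → Fin r → K) (e : Fin s ↪ Fin r), (∀ k, q (e k) = x k) ∧
      (∀ k l, k ≠ l → ∑ i, ν i * q k i * q l i = 0) ∧ ∀ k, ∑ i, ν i * q k i * q k i ≠ 0 := by
  classical
  let B : LinearMap.BilinForm K (Fin r → K) := Matrix.toBilin' (Matrix.diagonal ν)
  have hB : ∀ y z, B y z = ∑ i, ν i * y i * z i := by
    intro y z
    simp only [B, Matrix.toBilin'_apply, Matrix.diagonal_apply]
    refine Finset.sum_congr rfl fun i _ => ?_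
    rw [Finset.sum_eq_single i (fun j _ hj => by simp [hj.symm]) (by simp)]
    simp [mul_comm]
  have hsymm : B.IsSymm := ⟨fun y z => by
    simp only [hB]
    exact Finset.sum_congr rfl fun i _ => by ring⟩
  have hnd : B.Nondegenerate := by
    rw [LinearMap.BilinForm.nondegenerate_toBilin'_iff_det_ne_zero, Matrix.det_diagonal]
    exact Finset.prod_ne_zero_iff.2 fun i _ => hν i
  have : Invertible (2 : K) := invertibleOfNonzero two_ne_zero
  have hli : LinearIndependent K x := LinearMap.BilinForm.linearIndependent_of_iIsOrtho (B := B)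
    (fun k l hkl => (hB _ _).trans (hx k l hkl)) (fun k h => hx' k ((hB _ _).symm.trans h))
  let X := Submodule.span K (Set.range x)
  let bx : Module.Basis (Fin s) K X := Module.Basis.span hli
  have hbx : ∀ k, (bx k : Fin r → K) = x k := fun k =>
    congrArg Subtype.val (Module.Basis.span_apply hli k)
  have hXnd : (B.restrict X).Nondegenerate :=
    (LinearMap.BilinForm.iIsOrtho.nondegenerate_iff_not_isOrtho_basis_self (B.restrict X) bx
      fun k l hkl => by
        change B (bx k) (bx l) = 0
        rw [hbx, hbx, hB, hx k l hkl]).2 fun k h => hx' k <| by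
      change B (bx k) (bx k) = 0 at h
      rwa [hbx, hB] at h
  have hc : IsCompl X (B.orthogonal X) :=
    LinearMap.BilinForm.isCompl_orthogonal_of_restrict_nondegenerate hsymm.isRefl hXnd
  obtain ⟨v, hv⟩ := LinearMap.BilinForm.exists_orthogonal_basis (B := B.restrict (B.orthogonal X))
    ⟨fun y z => hsymm.eq y z⟩
  let u := (bx.prod v).map (Submodule.prodEquivOfIsCompl _ _ hc)
  have hul : ∀ k, u (Sum.inl k) = x k := fun k => by simp [u, hbx]
  have hur : ∀ k, u (Sum.inr k) = v k := fun k => by simp [u]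
  have hxv : ∀ k l, B (x k) (v l) = 0 := fun k l => (v l).2 _ (hbx k ▸ (bx k).2)
  have hu : B.iIsOrtho u := by
    rintro (k | k) (l | l) hkl
    · change B _ _ = 0
      rw [hul, hul, hB, hx k l fun h => hkl (congrArg _ h)]
    · change B _ _ = 0
      rw [hul, hur, hxv]
    · change B _ _ = 0
      rw [hul, hur, hsymm.eq_iff, hxv]
    · change B _ _ = 0
      rw [hur, hur]
      exact hv fun h => hkl (congrArg _ h)
  have hu' := hu.not_isOrtho_basis_self_of_nondegenerate hnd
  let E : Fin s ⊕ Fin (Module.finrank K (B.orthogonal X)) ≃ Fin r := u.indexEquiv (Pi.basisFun K _)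
  refine ⟨fun k => u (E.symm k), ⟨fun k => E (Sum.inl k), fun k l h => by simpa using h⟩,
    fun k => (congrArg u (E.symm_apply_apply _)).trans (hul k), fun k l hkl => ?_,
    fun k h => hu' (E.symm k) ((hB _ _).trans h)⟩
  exact (hB _ _).symm.trans (hu fun h => hkl (E.symm.injective h))

lemma sum_div_of_orthogonal {ν : Fin r → K} (hν : ∀ i, ν i ≠ 0) {q : Matrix (Fin r) (Fin r) K}
    (hq : ∀ k l, k ≠ l → ∑ i, ν i * q k i * q l i = 0) (hq' : ∀ k, ∑ i, ν i * q k i * q k i ≠ 0) :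
    qᵀ * Matrix.diagonal (fun k => (∑ i, ν i * q k i * q k i)⁻¹) * q =
      Matrix.diagonal fun i => (ν i)⁻¹ := by
  have h1 : q * (Matrix.diagonal ν * qᵀ * Matrix.diagonal fun k => (∑ i, ν i * q k i * q k i)⁻¹)
      = 1 := by
    rw [← Matrix.mul_assoc]
    ext k l
    rw [Matrix.mul_diagonal, Matrix.one_apply, Matrix.mul_apply]
    simp only [Matrix.diagonal_mul, Matrix.transpose_apply]
    have h2 : ∑ i, q k i * (ν i * q l i) = ∑ i, ν i * q k i * q l i :=
      Finset.sum_congr rfl fun i _ => by ring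
    rw [h2]
    split_ifs with h
    · subst h
      exact mul_inv_cancel₀ (hq' k)
    · rw [hq k l h, zero_mul]
  have h3 := mul_eq_one_comm.1 h1
  have h4 : Matrix.diagonal (fun i => (ν i)⁻¹) * Matrix.diagonal ν = 1 := by
    rw [Matrix.diagonal_mul_diagonal]
    simp [hν]
  calc _ = Matrix.diagonal (fun i => (ν i)⁻¹) * Matrix.diagonal ν *
        (qᵀ * Matrix.diagonal (fun k => (∑ i, ν i * q k i * q k i)⁻¹) * q) := by
        rw [h4, Matrix.one_mul]
    _ = Matrix.diagonal (fun i => (ν i)⁻¹) := by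
        simp only [Matrix.mul_assoc] at h3 ⊢
        rw [h3, Matrix.mul_one]

/-- Weighted sums of cubes of a basis and of an orthogonal family in the coordinates given by the
basis. -/
lemma inSimDiagClosure_of_orthogonal [CharZero K] (hn : n = r + m) {b : Fin n → Fin r → K}
    (hb : Submodule.span K (Set.range b) = ⊤) {c : Fin n → Fin n → K} (hc : ∀ i j, c i j = c j i)
    {g h : Matrix (Fin r) (Fin r) K} (hg : h * g = 1) {ν : Fin r → K} (hν : ∀ i, ν i ≠ 0)
    {x : Fin s → Fin r → K} (hx : ∀ k l, k ≠ l → ∑ i, ν i * x k i * x l i = 0)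
    (hx' : ∀ k, ∑ i, ν i * x k i * x k i ≠ 0) (σ : Fin r → K) (τ : Fin s → K) :
    InSimDiagClosure (famTuple b c fun a e f => ∑ k, σ k * g k a * g k e * g k f +
      ∑ k, τ k * (x k ᵥ* g) a * (x k ᵥ* g) e * (x k ᵥ* g) f) := by
  classical
  obtain ⟨γ, w, q', hcq, hinj⟩ := exists_quadratic_decomposition hn hb hc
  obtain ⟨q, e, hqe, hq, hq'⟩ := exists_orthogonal_extension ν hν x hx hx'
  have key := sum_div_of_orthogonal hν (q := Matrix.of q) hq hq'
  have := inSimDiagClosure_of_cubes hn hcq hinj g (Matrix.of q * g) h (fun i => (ν i)⁻¹)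
    (fun k => (∑ i, ν i * q k i * q k i)⁻¹) (fun i => inv_ne_zero (hν i))
    (fun k => inv_ne_zero (hq' k)) (fun a f => ?_) hg σ
    (Function.extend e τ 0)
  · have hT : ∀ F : Fin r → K, ∑ k, Function.extend e τ 0 k * F k = ∑ k, τ k * F (e k) :=
      fun F => (Fintype.sum_of_injective e e.injective _ _
        (fun k hk => by rw [Function.extend_apply' _ _ _ hk, Pi.zero_apply, zero_mul])
        fun k => by rw [e.injective.extend_apply]).symm
    have hgq : ∀ k, x k ᵥ* g = (Matrix.of q * g) (e k) := fun k => by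
      ext a
      rw [← hqe k]
      rfl
    simp only [mul_assoc, hT] at this
    simpa only [hgq, mul_assoc] using this
  · have h1 : gᵀ * Matrix.diagonal (fun i => (ν i)⁻¹) * g = (Matrix.of q * g)ᵀ *
        Matrix.diagonal (fun k => (∑ i, ν i * q k i * q k i)⁻¹) * (Matrix.of q * g) := by
      rw [← key, Matrix.transpose_mul]
      simp only [Matrix.mul_assoc]
      rfl
    have h2 : ∀ (M : Matrix (Fin r) (Fin r) K) (d : Fin r → K),
        (Mᵀ * Matrix.diagonal d * M) a f = ∑ k, d k * M k a * M k f := fun M d => by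
      rw [Matrix.mul_apply]
      simp only [Matrix.mul_diagonal, Matrix.transpose_apply]
      exact Finset.sum_congr rfl fun k _ => by ring
    refine (h2 g _).symm.trans (Eq.trans ?_ (h2 (Matrix.of q * g) _))
    exact congrFun (congrFun h1 a) f

/-- The symmetric trilinear form which is the sum of the cubes of the given vectors. -/
def cubeSum {ι : Type*} [Fintype ι] (x : ι → Fin r → K) (a e f : Fin r) : K :=
  ∑ p, x p a * x p e * x p f

/-- Sums of cubes of `r + s` vectors, given a polynomial choice of a diagonal form for which the
coordinates of the last `s` vectors in the basis of the first `r` vectors are orthogonal. -/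
lemma inSimDiagClosure_cubeSum [CharZero K] (hn : n = r + m) {b : Fin n → Fin r → K}
    (hb : Submodule.span K (Set.range b) = ⊤) {c : Fin n → Fin n → K} (hc : ∀ i j, c i j = c j i)
    (N : (Fin s → Fin r → K) → Fin r → K)
    (hN : ∀ x : K → Fin s → Fin r → K, (∀ k i, PolyFun fun t => x t k i) →
      ∀ i, PolyFun fun t => N (x t) i)
    (hNx : ∀ x k l, k ≠ l → ∑ i, N x i * x k i * x l i = 0) (x₀ : Fin s → Fin r → K)
    (h₀ : ∀ i, N x₀ i ≠ 0) (h₀' : ∀ k, ∑ i, N x₀ i * x₀ k i * x₀ k i ≠ 0)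
    (y : Fin r ⊕ Fin s → Fin r → K) : InSimDiagClosure (famTuple b c (cubeSum y)) := by
  classical
  let y₀ : Fin r ⊕ Fin s → Fin r → K := Sum.elim (fun k => Pi.single k 1) x₀
  let z : K → Fin r ⊕ Fin s → Fin r → K := fun t p i => y₀ p i + t * (y p i - y₀ p i)
  let g : K → Matrix (Fin r) (Fin r) K := fun t => Matrix.of fun k i => z t (Sum.inl k) i
  let x : K → Fin s → Fin r → K := fun t k => z t (Sum.inr k) ᵥ* (g t).adjugate
  have hz : ∀ p i, PolyFun fun t => z t p i := fun p i => by fun_prop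
  have hg : ∀ k i, PolyFun fun t => g t k i := fun k i => hz _ i
  have hx : ∀ k i, PolyFun fun t => x t k i := fun k i => by
    simp only [x, Matrix.vecMul, dotProduct]
    exact PolyFun.finsetSum _ fun j => (hz _ _).mul (PolyFun.adjugate hg _ _)
  have hNp := hN x hx
  have hg0 : g 0 = 1 := by
    ext k i
    simp [g, z, y₀, Matrix.one_apply, Pi.single_apply, eq_comm]
  have hx0 : x 0 = x₀ := by
    ext k i
    simp only [x, hg0, Matrix.adjugate_one, Matrix.vecMul_one]
    simp [z, y₀]
  have key := InSimDiagClosure.of_curve (A := fun t => famTuple b c (cubeSum (z t)))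
    (θ := fun t => (g t).det * ((∏ i, N (x t) i) * ∏ k, ∑ i, N (x t) i * x t k i * x t k i))
    (famTuple_polyFun (fun i j => PolyFun.const _) fun a e f => PolyFun.finsetSum _ fun p =>
      ((hz _ _).mul (hz _ _)).mul (hz _ _))
    ((PolyFun.det hg).mul <| (PolyFun.finsetProd _ hNp).mul <| PolyFun.finsetProd _ fun k =>
      PolyFun.finsetSum _ fun i => ((hNp i).mul (hx k i)).mul (hx k i))
    (t₀ := 0) (by
      rw [hg0, hx0, Matrix.det_one, one_mul]
      exact mul_ne_zero (Finset.prod_ne_zero_iff.2 fun i _ => h₀ i)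
        (Finset.prod_ne_zero_iff.2 fun k _ => h₀' k)) (fun t ht => ?_) 1
  · have hz1 : z 1 = y := by
      ext p i
      simp [z]
    rwa [hz1] at key
  · have hdet : (g t).det ≠ 0 := left_ne_zero_of_mul ht
    have ht' := right_ne_zero_of_mul ht
    have h1 := Finset.prod_ne_zero_iff.1 (left_ne_zero_of_mul ht')
    have h2 := Finset.prod_ne_zero_iff.1 (right_ne_zero_of_mul ht')
    have := inSimDiagClosure_of_orthogonal hn hb hc (g := g t) (h := (g t)⁻¹)
      (Matrix.nonsing_inv_mul _ hdet.isUnit) (fun i => h1 i (Finset.mem_univ i)) (hNx (x t))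
      (fun k => h2 k (Finset.mem_univ k)) 1 fun _ => ((g t).det ^ 3)⁻¹
    have hxg : ∀ k a, (x t k ᵥ* g t) a = (g t).det * z t (Sum.inr k) a := fun k a => by
      simp only [x, Matrix.vecMul_vecMul, Matrix.adjugate_mul, Matrix.vecMul_smul,
        Matrix.vecMul_one, Pi.smul_apply, smul_eq_mul]
    convert this using 2
    ext a e f
    simp only [cubeSum, Fintype.sum_sum_type, hxg]
    congr 1
    · simp [g]
    · exact Finset.sum_congr rfl fun k _ => by field_simp

lemma inSimDiagClosure_cubeSum_succ [CharZero K] (hr : 1 ≤ r) (hn : n = r + m)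
    {b : Fin n → Fin r → K} (hb : Submodule.span K (Set.range b) = ⊤) {c : Fin n → Fin n → K}
    (hc : ∀ i j, c i j = c j i) (y : Fin r ⊕ Fin 1 → Fin r → K) :
    InSimDiagClosure (famTuple b c (cubeSum y)) :=
  inSimDiagClosure_cubeSum hn hb hc (fun _ _ => 1) (fun _ _ _ => PolyFun.const 1)
    (fun _ k l h => absurd (Subsingleton.elim k l) h) (fun _ _ => 1) (fun _ => one_ne_zero)
    (fun _ => by simpa using Nat.one_le_iff_ne_zero.1 hr) y

/-- The coefficients of a diagonal form for which three vectors are pairwise orthogonal. -/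
def orthogonalizingForm (x : Fin 3 → Fin 5 → K) : Fin 5 → K :=
  let v : Fin 5 → Fin 3 → K := fun i => ![x 0 i * x 1 i, x 0 i * x 2 i, x 1 i * x 2 i]
  ![-(Matrix.of ![v 3 + v 4, v 1, v 2]).det, -(Matrix.of ![v 0, v 3 + v 4, v 2]).det,
    -(Matrix.of ![v 0, v 1, v 3 + v 4]).det, (Matrix.of ![v 0, v 1, v 2]).det,
    (Matrix.of ![v 0, v 1, v 2]).det]

/-- The last three vectors of a configuration of eight vectors in dimension five. -/
def extraPoints : Fin 3 → Fin 5 → K :=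
  ![![1, 1, 1, 1, 1], ![-1, -1, 0, -1, 1], ![-1, 0, -1, -1, 1]]

lemma inSimDiagClosure_cubeSum_five [CharZero K] (hn : n = 5 + m)
    {b : Fin n → Fin 5 → K} (hb : Submodule.span K (Set.range b) = ⊤) {c : Fin n → Fin n → K}
    (hc : ∀ i j, c i j = c j i) (y : Fin 5 ⊕ Fin 3 → Fin 5 → K) :
    InSimDiagClosure (famTuple b c (cubeSum y)) := by
  refine inSimDiagClosure_cubeSum hn hb hc orthogonalizingForm (fun x hx i => ?_)
    (fun x k l h => ?_) extraPoints (fun i => ?_) (fun k => ?_) y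
  · fin_cases i <;> simp [orthogonalizingForm, Matrix.det_fin_three] <;> fun_prop
  · fin_cases k <;> fin_cases l <;> first
      | exact absurd rfl h
      | (simp [orthogonalizingForm, Matrix.det_fin_three, Fin.sum_univ_five]; ring)
  · fin_cases i <;> simp [orthogonalizingForm, extraPoints, Matrix.det_fin_three]
  · fin_cases k <;>
      simp [orthogonalizingForm, extraPoints, Matrix.det_fin_three, Fin.sum_univ_five] <;> norm_num

end Points

section Dominance

variable {K : Type*} [Field K] {r : ℕ}

lemma derivative_aeval_mvPolynomial {σ : Type*} [Fintype σ] (f : σ → Polynomial K)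
    (Φ : MvPolynomial σ K) : Polynomial.derivative (MvPolynomial.aeval f Φ) =
      ∑ x, MvPolynomial.aeval f (MvPolynomial.pderiv x Φ) * Polynomial.derivative (f x) := by
  classical
  induction Φ using MvPolynomial.induction_on with
  | C a => simp
  | add p q hp hq => simp [hp, hq, add_mul, Finset.sum_add_distrib]
  | mul_X p n hp =>
    have h : ∀ x, MvPolynomial.aeval f (MvPolynomial.pderiv x (p * MvPolynomial.X n)) *
        Polynomial.derivative (f x) = MvPolynomial.aeval f (MvPolynomial.pderiv x p) *
          Polynomial.derivative (f x) * f n +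
        if x = n then MvPolynomial.aeval f p * Polynomial.derivative (f n) else 0 := by
      intro x
      rw [Derivation.leibniz, MvPolynomial.pderiv_X]
      split_ifs with hx
      · subst hx
        simp
        ring
      · simp [Ne.symm hx]
        ring
    simp only [h, Finset.sum_add_distrib, ← Finset.sum_mul, ← hp, Finset.sum_ite_eq',
      Finset.mem_univ, if_true, map_mul, MvPolynomial.aeval_X, Polynomial.derivative_mul]

lemma eval_aeval_mvPolynomial {σ : Type*} (f : σ → Polynomial K) (Φ : MvPolynomial σ K) (t : K) :
    (MvPolynomial.aeval f Φ).eval t = MvPolynomial.eval (fun x => (f x).eval t) Φ := by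
  induction Φ using MvPolynomial.induction_on with
  | C a => simp
  | add p q hp hq => simp [hp, hq]
  | mul_X p n hp => simp [hp]

/-- The value at a trilinear form of a polynomial in the coefficients of trilinear forms. -/
noncomputable def evalTrilinear (Ψ : MvPolynomial (Fin r × Fin r × Fin r) K)
    (T : Fin r → Fin r → Fin r → K) : K :=
  MvPolynomial.eval (fun x => T x.1 x.2.1 x.2.2) Ψ

lemma sum_pderiv_cubeSum [Infinite K] {ι : Type*} [Fintype ι]
    {Ψ : MvPolynomial (Fin r × Fin r × Fin r) K}
    (hΨ : ∀ y : ι → Fin r → K, evalTrilinear Ψ (cubeSum y) = 0) (y w : ι → Fin r → K) :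
    ∑ a, ∑ e, ∑ f, evalTrilinear (MvPolynomial.pderiv (a, e, f) Ψ) (cubeSum y) *
      ∑ p, (w p a * y p e * y p f + y p a * w p e * y p f + y p a * y p e * w p f) = 0 := by
  let F : Fin r × Fin r × Fin r → Polynomial K := fun x =>
    ∑ p, (Polynomial.C (y p x.1) + Polynomial.X * Polynomial.C (w p x.1)) *
      (Polynomial.C (y p x.2.1) + Polynomial.X * Polynomial.C (w p x.2.1)) *
      (Polynomial.C (y p x.2.2) + Polynomial.X * Polynomial.C (w p x.2.2))
  have hF : MvPolynomial.aeval F Ψ = 0 := Polynomial.funext fun t => by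
    rw [eval_aeval_mvPolynomial, Polynomial.eval_zero, ← hΨ fun p a => y p a + t * w p a]
    simp [F, evalTrilinear, cubeSum, Polynomial.eval_finsetSum, mul_comm t]
  have hd := congrArg (Polynomial.eval 0) (derivative_aeval_mvPolynomial F Ψ)
  rw [hF, Polynomial.derivative_zero, Polynomial.eval_zero, Polynomial.eval_finsetSum,
    Fintype.sum_prod_type] at hd
  simp only [Fintype.sum_prod_type] at hd
  rw [hd]
  refine Finset.sum_congr rfl fun a _ => Finset.sum_congr rfl fun e _ =>
    Finset.sum_congr rfl fun f _ => ?_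
  rw [Polynomial.eval_mul, eval_aeval_mvPolynomial]
  congr 1
  · simp [F, evalTrilinear, cubeSum, Polynomial.eval_finsetSum]
  · simp only [F, Polynomial.derivative_sum, Polynomial.eval_finsetSum]
    exact Finset.sum_congr rfl fun p _ => by
      simp
      ring

/-- The sum of a trilinear form over all permutations of its arguments. -/
def symmetrize (H : Fin r → Fin r → Fin r → K) (a e f : Fin r) : K :=
  H a e f + H a f e + H e a f + H e f a + H f a e + H f e a

lemma sum_symmetrize_mul (H : Fin r → Fin r → Fin r → K) (v : Fin r → K) (e : Fin r) :
    ∑ a, ∑ f, symmetrize H e a f * v a * v f =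
      2 * ∑ a, ∑ f, (H e a f + H a e f + H a f e) * v a * v f := by
  have h : ∀ F : Fin r → Fin r → K, ∑ a, ∑ f, F f a * v a * v f = ∑ a, ∑ f, F a f * v a * v f := by
    intro F
    rw [Finset.sum_comm]
    exact Finset.sum_congr rfl fun a _ => Finset.sum_congr rfl fun f _ => by ring
  simp only [symmetrize, add_mul, Finset.sum_add_distrib]
  rw [h fun a f => H e a f, h fun a f => H a e f, h fun a f => H a f e]
  ring

lemma sum_symmetrize_mul_of_symm (H v : Fin r → Fin r → Fin r → K)
    (h₁ : ∀ a e f, v a e f = v e a f) (h₂ : ∀ a e f, v a e f = v a f e) :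
    ∑ a, ∑ e, ∑ f, symmetrize H a e f * v a e f = 6 * ∑ a, ∑ e, ∑ f, H a e f * v a e f := by
  have s₁ : ∀ F : Fin r → Fin r → Fin r → K,
      ∑ a, ∑ e, ∑ f, F e a f = ∑ a, ∑ e, ∑ f, F a e f := fun F => Finset.sum_comm
  have s₂ : ∀ F : Fin r → Fin r → Fin r → K,
      ∑ a, ∑ e, ∑ f, F a f e = ∑ a, ∑ e, ∑ f, F a e f := fun F =>
    Finset.sum_congr rfl fun a _ => Finset.sum_comm
  have t₁ : ∀ F : Fin r → Fin r → Fin r → K,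
      ∑ a, ∑ e, ∑ f, F e a f * v a e f = ∑ a, ∑ e, ∑ f, F a e f * v a e f := fun F => by
    rw [← s₁ fun a e f => F a e f * v a e f]
    simp only [h₁]
  have t₂ : ∀ F : Fin r → Fin r → Fin r → K,
      ∑ a, ∑ e, ∑ f, F a f e * v a e f = ∑ a, ∑ e, ∑ f, F a e f * v a e f := fun F => by
    rw [← s₂ fun a e f => F a e f * v a e f]
    simp only [h₂]
  simp only [symmetrize, add_mul, Finset.sum_add_distrib]
  have t₃ := (t₁ fun a e f => H a f e).trans (t₂ H)
  rw [t₂ H, t₁ H, t₃, (t₂ fun a e f => H e a f).trans (t₁ H),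
    (t₂ fun a e f => H e f a).trans t₃]
  ring

/-- The derivative along a symmetric trilinear form of a polynomial vanishing on sums of cubes again
vanishes on sums of cubes, provided that the sums of cubes are dominant at some point. -/
lemma evalTrilinear_pderiv_cubeSum [CharZero K] {ι : Type*} [Fintype ι] (y₀ : ι → Fin r → K)
    (hy₀ : ∀ G : Fin r → Fin r → Fin r → K, (∀ a e f, G a e f = G e a f) →
      (∀ a e f, G a e f = G a f e) → (∀ p e, ∑ a, ∑ f, G e a f * y₀ p a * y₀ p f = 0) → G = 0)
    {Ψ : MvPolynomial (Fin r × Fin r × Fin r) K}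
    (hΨ : ∀ y : ι → Fin r → K, evalTrilinear Ψ (cubeSum y) = 0) {v : Fin r → Fin r → Fin r → K}
    (h₁ : ∀ a e f, v a e f = v e a f) (h₂ : ∀ a e f, v a e f = v a f e) (y : ι → Fin r → K) :
    ∑ a, ∑ e, ∑ f, evalTrilinear (MvPolynomial.pderiv (a, e, f) Ψ) (cubeSum y) * v a e f = 0 := by
  classical
  let z : K → ι → Fin r → K := fun t p i => y₀ p i + t * (y p i - y₀ p i)
  have hz : ∀ p i, PolyFun fun t => z t p i := fun p i => by fun_prop
  have hz0 : z 0 = y₀ := by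
    ext p i
    simp [z]
  have hz1 : z 1 = y := by
    ext p i
    simp [z]
  let H : K → Fin r → Fin r → Fin r → K := fun t a e f =>
    evalTrilinear (MvPolynomial.pderiv (a, e, f) Ψ) (cubeSum (z t))
  have hHp : ∀ a e f, PolyFun fun t => H t a e f := fun a e f =>
    PolyFun.mvPolynomial_eval (x := fun t (x : Fin r × Fin r × Fin r) =>
      cubeSum (z t) x.1 x.2.1 x.2.2) (fun x => PolyFun.finsetSum _ fun p =>
        ((hz _ _).mul (hz _ _)).mul (hz _ _)) _
  have hG : ∀ t p e, ∑ a, ∑ f, symmetrize (H t) e a f * z t p a * z t p f = 0 := by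
    intro t p e
    have h := sum_pderiv_cubeSum hΨ (z t) fun p' => if p' = p then Pi.single e 1 else 0
    rw [sum_symmetrize_mul]
    refine mul_eq_zero_of_right _ (Eq.trans ?_ h)
    have hw : ∀ a e' f, ∑ p', ((if p' = p then (Pi.single e 1 : Fin r → K) else 0) a * z t p' e' *
        z t p' f + z t p' a * (if p' = p then (Pi.single e 1 : Fin r → K) else 0) e' * z t p' f +
        z t p' a * z t p' e' * (if p' = p then (Pi.single e 1 : Fin r → K) else 0) f) =
        (if a = e then z t p e' * z t p f else 0) + (if e' = e then z t p a * z t p f else 0) +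
        if f = e then z t p a * z t p e' else 0 := by
      intro a e' f
      rw [Finset.sum_eq_single p (fun p' _ hp => by simp [hp]) (by simp)]
      simp [Pi.single_apply]
    simp only [hw]
    simp only [mul_add, add_mul, Finset.sum_add_distrib, mul_ite, mul_zero,
      Finset.sum_ite_irrel, Finset.sum_const_zero, Finset.sum_ite_eq', Finset.mem_univ, if_true,
      mul_assoc]
    rfl
  -- the linear conditions on a trilinear form imposed by the configuration
  let M : K → Matrix ((Fin r × Fin r × Fin r) ⊕ (Fin r × Fin r × Fin r) ⊕ (ι × Fin r))
      (Fin r × Fin r × Fin r) K := fun t => Matrix.of fun k x =>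
    match k with
    | Sum.inl u => (if x = u then 1 else 0) - if x = (u.2.1, u.1, u.2.2) then 1 else 0
    | Sum.inr (Sum.inl u) => (if x = u then 1 else 0) - if x = (u.1, u.2.2, u.2.1) then 1 else 0
    | Sum.inr (Sum.inr u) => if x.1 = u.2 then z t u.1 x.2.1 * z t u.1 x.2.2 else 0
  have hM : ∀ t (G : Fin r × Fin r × Fin r → K), M t *ᵥ G =
      Sum.elim (fun u => G u - G (u.2.1, u.1, u.2.2))
      (Sum.elim (fun u => G u - G (u.1, u.2.2, u.2.1)) fun u => ∑ a, ∑ f, G (u.2, a, f) *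
        z t u.1 a * z t u.1 f) := by
    intro t G
    ext (u | u | u)
    · simp [M, Matrix.mulVec, dotProduct, sub_mul, Finset.sum_sub_distrib]
    · simp [M, Matrix.mulVec, dotProduct, sub_mul, Finset.sum_sub_distrib]
    · simp only [M, Matrix.mulVec, dotProduct, Matrix.of_apply, Sum.elim_inr, ite_mul, zero_mul,
        Fintype.sum_prod_type, Finset.sum_ite_irrel, Finset.sum_const_zero, Finset.sum_ite_eq',
        Finset.mem_univ, if_true]
      exact Finset.sum_congr rfl fun a _ => Finset.sum_congr rfl fun f _ => by ring
  have hMp : ∀ k x, PolyFun fun t => M t k x := by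
    have h0 : PolyFun fun _ : K => (0 : K) := PolyFun.const 0
    rintro (u | u | u) x
    · exact PolyFun.const _
    · exact PolyFun.const _
    · simp only [M, Matrix.of_apply]
      split_ifs
      · exact (hz _ _).mul (hz _ _)
      · exact h0
  have hinj : Function.Injective (M 0).mulVecLin := by
    rw [← LinearMap.ker_eq_bot, LinearMap.ker_eq_bot']
    intro G h
    rw [Matrix.mulVecLin_apply, hM, hz0] at h
    have h0 := hy₀ (fun a e f => G (a, e, f))
      (fun a e f => sub_eq_zero.1 (congrFun h (Sum.inl (a, e, f))))
      (fun a e f => sub_eq_zero.1 (congrFun h (Sum.inr (Sum.inl (a, e, f)))))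
      fun p e => congrFun h (Sum.inr (Sum.inr (p, e)))
    ext ⟨a, e, f⟩
    exact congrFun (congrFun (congrFun h0 a) e) f
  obtain ⟨L, hL⟩ := (M 0).mulVecLin.exists_leftInverse_of_injective (LinearMap.ker_eq_bot.2 hinj)
  let L' := LinearMap.toMatrix' L
  have hL' : L' * M 0 = 1 := by
    rw [← LinearMap.toMatrix'_id, ← hL, LinearMap.toMatrix'_comp]
    congr 1
    exact (LinearMap.toMatrix'_toLin' (M 0)).symm
  have hker : ∀ t, M t *ᵥ (fun x => symmetrize (H t) x.1 x.2.1 x.2.2) = 0 := by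
    intro t
    rw [hM]
    ext (u | u | u)
    · simp only [Sum.elim_inl, symmetrize, Pi.zero_apply]
      ring
    · simp only [Sum.elim_inr, Sum.elim_inl, symmetrize, Pi.zero_apply]
      ring
    · exact hG t u.1 u.2
  have hzero : ∀ a e f, symmetrize (H 1) a e f = 0 := by
    intro a e f
    refine PolyFun.eq_zero_of_mul_eq_zero (f := fun t => symmetrize (H t) a e f)
      (g := fun t => (L' * M t).det) ?_ ?_ (fun t => ?_) (t₀ := 0) (by simp [hL']) 1
    · simp only [symmetrize]
      fun_prop
    · exact PolyFun.det fun i j =>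
        PolyFun.matrixMul (M := fun _ => L') (fun _ _ => PolyFun.const _) hMp i j
    · have h3 : (L' * M t).adjugate *ᵥ (L' *ᵥ (M t *ᵥ
          (fun x => symmetrize (H t) x.1 x.2.1 x.2.2))) = 0 := by simp [hker]
      rw [Matrix.mulVec_mulVec, Matrix.mulVec_mulVec, Matrix.mul_assoc, Matrix.adjugate_mul] at h3
      have := congrFun h3 (a, e, f)
      simpa [Matrix.smul_mulVec, mul_comm] using this
  have h6 := sum_symmetrize_mul_of_symm (H 1) v h₁ h₂
  simp only [hzero, zero_mul, Finset.sum_const_zero] at h6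
  have h7 := (mul_eq_zero.1 h6.symm).resolve_left (by norm_num)
  simpa only [H, hz1] using h7

/-- Polynomials vanishing on sums of cubes vanish on all symmetric trilinear forms, provided that
the sums of cubes are dominant at some point. -/
lemma evalTrilinear_eq_zero [CharZero K] {ι : Type*} [Fintype ι] (y₀ : ι → Fin r → K)
    (hy₀ : ∀ G : Fin r → Fin r → Fin r → K, (∀ a e f, G a e f = G e a f) →
      (∀ a e f, G a e f = G a f e) → (∀ p e, ∑ a, ∑ f, G e a f * y₀ p a * y₀ p f = 0) → G = 0)
    {Ψ : MvPolynomial (Fin r × Fin r × Fin r) K}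
    (hΨ : ∀ y : ι → Fin r → K, evalTrilinear Ψ (cubeSum y) = 0) {v : Fin r → Fin r → Fin r → K}
    (h₁ : ∀ a e f, v a e f = v e a f) (h₂ : ∀ a e f, v a e f = v a f e) :
    evalTrilinear Ψ v = 0 := by
  let F : Fin r × Fin r × Fin r → Polynomial K := fun x =>
    Polynomial.X * Polynomial.C (v x.1 x.2.1 x.2.2)
  have key : ∀ (k : ℕ) (Ψ : MvPolynomial (Fin r × Fin r × Fin r) K),
      (∀ y : ι → Fin r → K, evalTrilinear Ψ (cubeSum y) = 0) →
        (MvPolynomial.aeval F Ψ).coeff k = 0 := by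
    intro k
    induction k with
    | zero =>
      intro Ψ hΨ
      rw [Polynomial.coeff_zero_eq_eval_zero, eval_aeval_mvPolynomial]
      refine Eq.trans ?_ (hΨ 0)
      simp [F, evalTrilinear, cubeSum]
    | succ k ih =>
      intro Ψ hΨ
      have h := ih (∑ x, MvPolynomial.pderiv x Ψ * MvPolynomial.C (v x.1 x.2.1 x.2.2)) fun y => by
        have := evalTrilinear_pderiv_cubeSum y₀ hy₀ hΨ h₁ h₂ y
        simpa [evalTrilinear, Fintype.sum_prod_type] using this
      have hd : MvPolynomial.aeval F (∑ x, MvPolynomial.pderiv x Ψ *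
          MvPolynomial.C (v x.1 x.2.1 x.2.2)) =
          Polynomial.derivative (MvPolynomial.aeval F Ψ) := by
        rw [derivative_aeval_mvPolynomial, map_sum]
        exact Finset.sum_congr rfl fun x _ => by simp [F]
      rw [hd, Polynomial.coeff_derivative] at h
      exact (mul_eq_zero.1 h).resolve_right (by exact_mod_cast k.succ_ne_zero)
  have h0 : MvPolynomial.aeval F Ψ = 0 := Polynomial.ext fun k => by
    rw [key k Ψ hΨ, Polynomial.coeff_zero]
  have := eval_aeval_mvPolynomial F Ψ 1
  rw [h0, Polynomial.eval_zero] at this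
  simpa [F, evalTrilinear] using this.symm

lemma inSimDiagClosure_of_forall_cubeSum [CharZero K] {n : ℕ} {b : Fin n → Fin r → K}
    {c : Fin n → Fin n → K} {ι : Type*} [Fintype ι] (y₀ : ι → Fin r → K)
    (hy₀ : ∀ G : Fin r → Fin r → Fin r → K, (∀ a e f, G a e f = G e a f) →
      (∀ a e f, G a e f = G a f e) → (∀ p e, ∑ a, ∑ f, G e a f * y₀ p a * y₀ p f = 0) → G = 0)
    (h : ∀ y : ι → Fin r → K, InSimDiagClosure (famTuple b c (cubeSum y)))
    {T : Fin r → Fin r → Fin r → K} (h₁ : ∀ a e f, T a e f = T e a f)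
    (h₂ : ∀ a e f, T a e f = T a f e) : InSimDiagClosure (famTuple b c T) := by
  intro Φ hΦ
  have hP : ∀ x : Fin n × (Fin 1 ⊕ (Fin r ⊕ (Fin n ⊕ Fin 1))) × (Fin 1 ⊕ (Fin r ⊕ (Fin n ⊕ Fin 1))),
      ∃ P, ∀ T, evalTrilinear P T = famTuple b c T x.1 x.2.1 x.2.2 := by
    have hC : ∀ k : K, ∃ P, ∀ T : Fin r → Fin r → Fin r → K, evalTrilinear P T = k := fun k =>
      ⟨MvPolynomial.C k, fun T => by simp [evalTrilinear]⟩
    rintro ⟨i, p | p | p | p, q | q | q | q⟩ <;>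
      simp only [famTuple, blockMat1rn1, Matrix.of_apply] <;> try exact hC _
    exact ⟨∑ e, ∑ f, MvPolynomial.X (p, e, f) * MvPolynomial.C (b i e) * MvPolynomial.C (b q f),
      fun T => by simp [evalTrilinear]⟩
  choose P hP using hP
  have hΨ : ∀ T, evalTrilinear (MvPolynomial.bind₁ P Φ) T =
      MvPolynomial.eval (fun x => famTuple b c T x.1 x.2.1 x.2.2) Φ := by
    intro T
    simp only [← hP]
    simp only [evalTrilinear, MvPolynomial.eval, MvPolynomial.eval₂Hom_bind₁]
  rw [← hΨ]
  exact evalTrilinear_eq_zero y₀ hy₀ (fun y => (hΨ _).trans (h y Φ hΦ)) h₁ h₂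

lemma trilinear_eq_zero {G : Fin r → Fin r → Fin r → K} (h₁ : ∀ a e f, G a e f = G e a f)
    (h₂ : ∀ a e f, G a e f = G a f e) (hd : ∀ a e, G e a a = 0)
    (hlt : ∀ a e f, a < e → e < f → G a e f = 0) : G = 0 := by
  ext a e f
  rw [Pi.zero_apply, Pi.zero_apply, Pi.zero_apply]
  rcases lt_trichotomy a e with h | h | h <;> rcases lt_trichotomy e f with h' | h' | h' <;>
    rcases lt_trichotomy a f with h'' | h'' | h'' <;> grind

lemma cubeSum_succ_dominant [CharZero K] (hr : r ≤ 4) (G : Fin r → Fin r → Fin r → K)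
    (h₁ : ∀ a e f, G a e f = G e a f) (h₂ : ∀ a e f, G a e f = G a f e)
    (h : ∀ (p : Fin r ⊕ Fin 1) e, ∑ a, ∑ f, G e a f *
      (Sum.elim (fun k => Pi.single k 1) (fun _ _ => 1) : Fin r ⊕ Fin 1 → Fin r → K) p a *
      (Sum.elim (fun k => Pi.single k 1) (fun _ _ => 1) : Fin r ⊕ Fin 1 → Fin r → K) p f = 0) :
    G = 0 := by
  have hd : ∀ a e, G e a a = 0 := fun a e => by simpa [Pi.single_apply] using h (Sum.inl a) e
  have hs : ∀ e, ∑ a, ∑ f, G e a f = 0 := fun e => by simpa using h (Sum.inr 0) e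
  refine trilinear_eq_zero h₁ h₂ hd fun a e f ha he => ?_
  clear h
  interval_cases r
  · exact a.elim0
  · omega
  · omega
  · have := hs 0
    simp only [Fin.sum_univ_three] at this
    obtain ⟨rfl, rfl, rfl⟩ : a = 0 ∧ e = 1 ∧ f = 2 := by omega
    grind
  · have e0 := hs 0
    have e1 := hs 1
    have e2 := hs 2
    have e3 := hs 3
    have d₁ : ∀ a e, G a a e = 0 := fun a e => by rw [h₂, h₁, hd]
    have d₂ : ∀ a e, G a e a = 0 := fun a e => by rw [h₁, hd]
    simp only [Fin.sum_univ_four, hd, d₁, d₂] at e0 e1 e2 e3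
    have k : G 0 1 2 = 0 ∧ G 0 1 3 = 0 ∧ G 0 2 3 = 0 ∧ G 1 2 3 = 0 := by
      have := h₂ 0 1 2
      have := h₂ 0 1 3
      have := h₂ 0 2 3
      have := h₂ 1 0 2
      have := h₂ 1 0 3
      have := h₂ 1 2 3
      refine ⟨?_, ?_, ?_, ?_⟩ <;> grind
    fin_cases a <;> fin_cases e <;> fin_cases f <;> simp at ha he ⊢ <;> simp [k]

lemma cubeSum_five_dominant [CharZero K] (G : Fin 5 → Fin 5 → Fin 5 → K)
    (h₁ : ∀ a e f, G a e f = G e a f) (h₂ : ∀ a e f, G a e f = G a f e)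
    (h : ∀ (p : Fin 5 ⊕ Fin 3) e, ∑ a, ∑ f, G e a f *
      (Sum.elim (fun k => Pi.single k 1) extraPoints : Fin 5 ⊕ Fin 3 → Fin 5 → K) p a *
      (Sum.elim (fun k => Pi.single k 1) extraPoints : Fin 5 ⊕ Fin 3 → Fin 5 → K) p f = 0) :
    G = 0 := by
  have hd : ∀ a e, G e a a = 0 := fun a e => by simpa [Pi.single_apply] using h (Sum.inl a) e
  have d₁ : ∀ a e, G a a e = 0 := fun a e => by rw [h₂, h₁, hd]
  have d₂ : ∀ a e, G a e a = 0 := fun a e => by rw [h₁, hd]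
  have hs : ∀ (p : Fin 3) e, ∑ a, ∑ f, G e a f * extraPoints p a * extraPoints p f = 0 :=
    fun p => h (Sum.inr p)
  clear h
  have x₀ : (extraPoints 0 : Fin 5 → K) = ![1, 1, 1, 1, 1] := rfl
  have x₁ : (extraPoints 1 : Fin 5 → K) = ![-1, -1, 0, -1, 1] := rfl
  have x₂ : (extraPoints 2 : Fin 5 → K) = ![-1, 0, -1, -1, 1] := rfl
  have s₁ : ∀ a e f, e < a → G a e f = G e a f := fun a e f _ => h₁ a e f
  have s₂ : ∀ a e f, f < e → G a e f = G a f e := fun a e f _ => h₂ a e f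
  have e00 := hs 0 0
  have e01 := hs 0 1
  have e02 := hs 0 2
  have e03 := hs 0 3
  have e04 := hs 0 4
  have e10 := hs 1 0
  have e11 := hs 1 1
  have e12 := hs 1 2
  have e13 := hs 1 3
  have e14 := hs 1 4
  have e20 := hs 2 0
  have e21 := hs 2 1
  have e22 := hs 2 2
  have e23 := hs 2 3
  have e24 := hs 2 4
  simp [x₀, x₁, x₂, Fin.sum_univ_five, hd, d₁, d₂, s₁, s₂]
    at e00 e01 e02 e03 e04 e10 e11 e12 e13 e14 e20 e21 e22 e23 e24
  have k : G 0 1 2 = 0 ∧ G 0 1 3 = 0 ∧ G 0 1 4 = 0 ∧ G 0 2 3 = 0 ∧ G 0 2 4 = 0 ∧ G 0 3 4 = 0 ∧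
      G 1 2 3 = 0 ∧ G 1 2 4 = 0 ∧ G 1 3 4 = 0 ∧ G 2 3 4 = 0 := by
    clear h₁ h₂ hd d₁ d₂ s₁ s₂ hs
    refine ⟨?_, ?_, ?_, ?_, ?_, ?_, ?_, ?_, ?_, ?_⟩ <;> grind
  refine trilinear_eq_zero h₁ h₂ hd fun a e f ha he => ?_
  fin_cases a <;> fin_cases e <;> fin_cases f <;> simp at ha he ⊢ <;> simp [k]

end Dominance

section Reduction

variable {K : Type*} [Field K] {n r : ℕ}

lemma exists_dual_family {b : Fin n → Fin r → K} (hb : Submodule.span K (Set.range b) = ⊤) :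
    ∃ s : Fin r → Fin n → K, ∀ x : Fin r → K, ∀ a, ∑ i, s a i * ∑ e, b i e * x e = x a := by
  have h : ∀ a : Fin r, ∃ s : Fin n → K, ∑ i, s i • b i = Pi.single a 1 := fun a =>
    (Submodule.mem_span_range_iff_exists_fun K).1 (hb ▸ Submodule.mem_top)
  choose s hs using h
  refine ⟨s, fun x a => ?_⟩
  have h' : ∀ e, ∑ i, s a i * b i e = (Pi.single a 1 : Fin r → K) e := fun e => by
    simpa using congrFun (hs a) e
  calc ∑ i, s a i * ∑ e, b i e * x e = ∑ e, (∑ i, s a i * b i e) * x e := by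
        simp only [Finset.mul_sum, Finset.sum_mul]
        rw [Finset.sum_comm]
        simp only [mul_assoc]
    _ = x a := by simp [h', Pi.single_apply]

/-- Matrices satisfying the commutation relations of block tuples come from a symmetric tensor. -/
lemma exists_symmetric_tensor {b : Fin n → Fin r → K} (hb : Submodule.span K (Set.range b) = ⊤)
    {D : Fin n → Matrix (Fin r) (Fin n) K} (h₁ : ∀ i j a, D i a j = D j a i)
    (h₂ : ∀ i j k, ∑ a, b i a * D j a k = ∑ a, b j a * D i a k) :
    ∃ T : Fin r → Fin r → Fin r → K, (∀ a e f, T a e f = T e a f) ∧ (∀ a e f, T a e f = T a f e) ∧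
      ∀ i a j, D i a j = ∑ e, ∑ f, T a e f * b i e * b j f := by
  obtain ⟨s, hs⟩ := exists_dual_family hb
  have hD : ∀ i a j, D i a j = ∑ e, b i e * ∑ l, s a l * D l e j := by
    intro i a j
    rw [← hs (fun a => D i a j) a]
    simp only [h₂ _ i j, Finset.mul_sum]
    rw [Finset.sum_comm]
    simp only [mul_left_comm]
  have hM : ∀ e f l, ∑ k, s e k * D k f l = ∑ k, s f k * D k e l := by
    intro e f l
    have : ∀ e f, ∑ k, s e k * D k f l = ∑ k, ∑ m, s e k * s f m * ∑ a, b m a * D k a l := by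
      intro e f
      refine Finset.sum_congr rfl fun k _ => ?_
      rw [← hs (fun a => D k a l) f, Finset.mul_sum]
      simp only [mul_assoc]
    rw [this, this, Finset.sum_comm]
    simp only [h₂ _ _ l, mul_comm (s e _)]
  refine ⟨fun a e f => ∑ l, s a l * ∑ k, s e k * D k f l, fun a e f => ?_, fun a e f => ?_,
    fun i a j => ?_⟩
  · simp only [Finset.mul_sum]
    rw [Finset.sum_comm]
    refine Finset.sum_congr rfl fun k _ => Finset.sum_congr rfl fun l _ => ?_
    rw [h₁ k l]
    ring
  · simp only [hM e f]
  · rw [hD]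
    refine Finset.sum_congr rfl fun e _ => ?_
    have : ∀ l, D l e j = ∑ f, b j f * ∑ k, s e k * D k f l := fun l => by rw [h₁, hD]
    simp only [this, Finset.mul_sum, Finset.sum_mul]
    rw [Finset.sum_comm]
    refine Finset.sum_congr rfl fun f _ => Finset.sum_congr rfl fun l _ =>
      Finset.sum_congr rfl fun k _ => ?_
    ring

lemma inSimDiagClosure_famTuple [CharZero K] {m : ℕ} (hr : 1 ≤ r) (hr₅ : r ≤ 5) (hn : n = r + m)
    {b : Fin n → Fin r → K} (hb : Submodule.span K (Set.range b) = ⊤) {c : Fin n → Fin n → K}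
    (hc : ∀ i j, c i j = c j i) {T : Fin r → Fin r → Fin r → K} (h₁ : ∀ a e f, T a e f = T e a f)
    (h₂ : ∀ a e f, T a e f = T a f e) : InSimDiagClosure (famTuple b c T) := by
  obtain rfl | h := hr₅.eq_or_lt
  · exact inSimDiagClosure_of_forall_cubeSum _ cubeSum_five_dominant
      (inSimDiagClosure_cubeSum_five hn hb hc) h₁ h₂
  · exact inSimDiagClosure_of_forall_cubeSum _ (cubeSum_succ_dominant (Nat.le_of_lt_succ h))
      (inSimDiagClosure_cubeSum_succ hr hn hb hc) h₁ h₂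

/-- The change of basis acting on the third block only. -/
def thirdBlock (r : ℕ) (F : Matrix (Fin n) (Fin n) K) :
    Matrix (Fin 1 ⊕ (Fin r ⊕ (Fin n ⊕ Fin 1))) (Fin 1 ⊕ (Fin r ⊕ (Fin n ⊕ Fin 1))) K :=
  fromBlocks 1 0 0 (fromBlocks 1 0 0 (fromBlocks F 0 0 1))

lemma blockMat1rn1_mul_thirdBlock (F : Matrix (Fin n) (Fin n) K) (b : Fin r → K) (c : Fin n → K)
    (D : Matrix (Fin r) (Fin n) K) (v : Fin n → K) :
    blockMat1rn1 b c D (F *ᵥ v) * thirdBlock r F =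
      thirdBlock r F * blockMat1rn1 b (c ᵥ* F) (D * F) v := by
  ext (p | p | p | p) (q | q | q | q) <;>
    simp [thirdBlock, blockMat1rn1, Matrix.mul_apply, Matrix.vecMul, Matrix.mulVec, dotProduct,
      Matrix.one_apply, Fin.fin_one_eq_zero]

lemma blockMat1rn1_commute {b b' : Fin r → K} {c c' : Fin n → K} {D D' : Matrix (Fin r) (Fin n) K}
    {v v' : Fin n → K} (h : blockMat1rn1 b c D v * blockMat1rn1 b' c' D' v' =
      blockMat1rn1 b' c' D' v' * blockMat1rn1 b c D v) :
    c ⬝ᵥ v' = c' ⬝ᵥ v ∧ D *ᵥ v' = D' *ᵥ v ∧ b ᵥ* D' = b' ᵥ* D := by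
  refine ⟨?_, funext fun a => ?_, funext fun k => ?_⟩
  · simpa [blockMat1rn1, Matrix.mul_apply, dotProduct] using
      congrFun (congrFun h (Sum.inl 0)) (Sum.inr (Sum.inr (Sum.inr 0)))
  · simpa [blockMat1rn1, Matrix.mul_apply, dotProduct, Matrix.mulVec] using
      congrFun (congrFun h (Sum.inr (Sum.inl a))) (Sum.inr (Sum.inr (Sum.inr 0)))
  · simpa [blockMat1rn1, Matrix.mul_apply, dotProduct, Matrix.vecMul] using
      congrFun (congrFun h (Sum.inl 0)) (Sum.inr (Sum.inr (Sum.inl k)))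

end Reduction

/-- **Corollary 5.5 (s=r).** Algebras corresponding to n-tuples from `X_{n,r,r}` are
smoothable when `r ≤ n` and `r + n ≤ 11`, in matrix form. -/
theorem stmt14 {K : Type*} [Field K] [CharZero K] [IsAlgClosed K]
    {n r : ℕ} (hr : 1 ≤ r) (hrn : r ≤ n) (hnr : r + n ≤ 11)
    (b : Fin n → (Fin r → K)) (c : Fin n → (Fin n → K))
    (D : Fin n → Matrix (Fin r) (Fin n) K) (f : Fin n → (Fin n → K))
    (A : Fin n → Matrix (Fin 1 ⊕ (Fin r ⊕ (Fin n ⊕ Fin 1))) (Fin 1 ⊕ (Fin r ⊕ (Fin n ⊕ Fin 1))) K)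
    (hA : A = fun i => blockMat1rn1 (b i) (c i) (D i) (f i))
    (hcomm : ∀ i j, A i * A j = A j * A i)
    (hf : LinearIndependent K f)
    (hD : (⨆ i, LinearMap.range (Matrix.mulVecLin (D i))) = ⊤)
    (hb : Submodule.span K (Set.range b) = ⊤) :
    InSimDiagClosure A := by
  subst hA
  have hrel := fun i j => blockMat1rn1_commute (hcomm i j)
  set F : Matrix (Fin n) (Fin n) K := (Matrix.of f)ᵀ with hF
  have hFu : IsUnit F := by
    rw [hF, Matrix.isUnit_transpose]
    exact Matrix.linearIndependent_rows_iff_isUnit.1 hf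
  have hfF : ∀ i, f i = F *ᵥ Pi.single i 1 := fun i => by
    rw [Matrix.mulVec_single_one]
    rfl
  have hcF : ∀ i j, (c i ᵥ* F) j = c i ⬝ᵥ f j := fun _ _ => rfl
  have hDF : ∀ i a j, (D i * F) a j = (D i *ᵥ f j) a := fun _ _ _ => rfl
  have hP : IsUnit (thirdBlock r F) := by
    rw [Matrix.isUnit_iff_isUnit_det] at hFu ⊢
    simpa [thirdBlock, Matrix.det_fromBlocks_zero₂₁] using hFu
  obtain ⟨T, h₁, h₂, hT⟩ := exists_symmetric_tensor hb (D := fun i => D i * F)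
    (fun i j a => by rw [hDF, hDF, (hrel i j).2.1])
    (fun i j k => by
      have := congrFun (congrArg (· ᵥ* F) (hrel i j).2.2) k
      simp only [Matrix.vecMul_vecMul] at this
      exact this)
  refine InSimDiagClosure.of_mul_eq_mul (B := famTuple b (fun i => c i ᵥ* F) T)
    (inSimDiagClosure_famTuple hr (by omega) (Nat.add_sub_cancel' hrn).symm hb
      (fun i j => by rw [hcF, hcF, (hrel i j).1]) h₁ h₂) hP fun i => ?_
  have hDT : (Matrix.of fun a j => ∑ e, ∑ f, T a e f * b i e * b j f) = D i * F := by
    ext a j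
    exact (hT i a j).symm
  rw [famTuple, hDT, ← blockMat1rn1_mul_thirdBlock, ← hfF]
end

section
/- Let K be an algebraically closed field of characteristic 0, let 1 ≤ s ≤ r ≤ n, and set d = n + r + 2. Let X ⊆ (M_d(K))^n be the set of n-tuples (A_1,…,A_n) of pairwise commuting d×d matrices for which there exists an invertible d×d matrix P such that each P⁻¹A_iP has the block form (with rows and columns partitioned into blocks of sizes 1, r, n, 1, and only possibly nonzero blocks the (1,2) block b_iᵀ with b_i ∈ K^r, the (1,3) block c_iᵀ with c_i ∈ K^n, the (2,3) block D_i ∈ M_{r×n}(K), and the (3,4) block f_i ∈ K^n) where f_1,…,f_n are linearly independent, the images of D_1,…,D_n together span K^r, and the span of b_1,…,b_n has dimension s. Then X is nonempty and irreducible; concretely, for all polynomials f, g over K in the n·d² matrix entries, if the product f·g vanishes at every point of X, then f vanishes at every point of X or g vanishes at every point of X. -/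
open Matrix

/-- The locus `X^s_{n,r}`: commuting tuples conjugate to a block form with blocks of sizes
1, r, n, 1, with `f₁,…,fₙ` linearly independent, `D₁,…,Dₙ` of trivial common cokernel, and
`dim span{b₁,…,bₙ} = s`. -/
def locusX {K : Type*} [Field K] (n r s : ℕ) :
    Set (Fin n → Matrix (Fin 1 ⊕ (Fin r ⊕ (Fin n ⊕ Fin 1))) (Fin 1 ⊕ (Fin r ⊕ (Fin n ⊕ Fin 1))) K) :=
  {A | (∀ i j, A i * A j = A j * A i) ∧
    ∃ P : Matrix (Fin 1 ⊕ (Fin r ⊕ (Fin n ⊕ Fin 1))) (Fin 1 ⊕ (Fin r ⊕ (Fin n ⊕ Fin 1))) K,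
      IsUnit P ∧
      ∃ (b : Fin n → (Fin r → K)) (c : Fin n → (Fin n → K))
        (D : Fin n → Matrix (Fin r) (Fin n) K) (f : Fin n → (Fin n → K)),
        (∀ i, P⁻¹ * A i * P = blockMat1rn1 (b i) (c i) (D i) (f i)) ∧
        LinearIndependent K f ∧
        (⨆ i, LinearMap.range (Matrix.mulVecLin (D i))) = ⊤ ∧
        Module.finrank K ↥(Submodule.span K (Set.range b)) = s}

/-- Two linear maps of the same rank between finite-dimensional spaces are equivalent. -/
theorem LinearMap.exists_equivalence_of_finrank_range_eq {K V W : Type*} [Field K]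
    [AddCommGroup V] [Module K V] [FiniteDimensional K V]
    [AddCommGroup W] [Module K W] [FiniteDimensional K W] (f g : V →ₗ[K] W)
    (h : Module.finrank K (LinearMap.range f) = Module.finrank K (LinearMap.range g)) :
    ∃ (α : V ≃ₗ[K] V) (β : W ≃ₗ[K] W), ∀ x, g x = β (f (α x)) := by
  let σ : LinearMap.range f ≃ₗ[K] LinearMap.range g := LinearEquiv.ofFinrankEq _ _ h
  obtain ⟨β, hβ⟩ := Submodule.exists_linearEquiv_restrict_eq σ
  obtain ⟨C, hC⟩ := Submodule.exists_isCompl (LinearMap.ker f)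
  obtain ⟨C', hC'⟩ := Submodule.exists_isCompl (LinearMap.ker g)
  have hker : Module.finrank K (LinearMap.ker g) = Module.finrank K (LinearMap.ker f) := by
    have h1 := LinearMap.finrank_range_add_finrank_ker f
    have h2 := LinearMap.finrank_range_add_finrank_ker g
    omega
  let e : LinearMap.ker g ≃ₗ[K] LinearMap.ker f := LinearEquiv.ofFinrankEq _ _ hker
  let τ : C' ≃ₗ[K] C := (g.kerComplementEquivRange hC'.symm).trans
    (σ.symm.trans (f.kerComplementEquivRange hC.symm).symm)
  have hτ : ∀ y : C', g y = β (f (τ y)) := by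
    intro y
    have h1 : f.kerComplementEquivRange hC.symm (τ y) =
        σ.symm (g.kerComplementEquivRange hC'.symm y) := by
      rw [← LinearEquiv.eq_symm_apply]; rfl
    have h2 : (⟨f (τ y), LinearMap.mem_range_self f _⟩ : LinearMap.range f) =
        σ.symm ⟨g y, LinearMap.mem_range_self g _⟩ := h1
    have h3 := hβ ⟨f (τ y), LinearMap.mem_range_self f _⟩
    rw [← h3, h2, LinearEquiv.apply_symm_apply]
  refine ⟨((LinearMap.ker g).prodEquivOfIsCompl C' hC').symm ≪≫ₗ (e.prodCongr τ) ≪≫ₗ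
    (LinearMap.ker f).prodEquivOfIsCompl C hC, β, fun x => ?_⟩
  obtain ⟨⟨a, y⟩, rfl⟩ := ((LinearMap.ker g).prodEquivOfIsCompl C' hC').surjective x
  have ha : g a = 0 := a.2
  have hea : f (e a) = 0 := (e a).2
  simp [ha, hea, hτ]

/-- Two matrices of the same rank over a field are equivalent. -/
theorem Matrix.exists_isUnit_mul_mul_eq_of_rank_eq {K m n : Type*} [Field K]
    [Fintype m] [DecidableEq m] [Fintype n] [DecidableEq n] (A B : Matrix m n K)
    (h : A.rank = B.rank) :
    ∃ (G : Matrix m m K) (M : Matrix n n K), IsUnit G ∧ IsUnit M ∧ B = G * A * M := by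
  obtain ⟨α, β, hαβ⟩ :=
    LinearMap.exists_equivalence_of_finrank_range_eq A.mulVecLin B.mulVecLin h
  refine ⟨LinearMap.toMatrix' β.toLinearMap, LinearMap.toMatrix' α.toLinearMap, ?_, ?_, ?_⟩
  · exact IsUnit.of_mul_eq_one (LinearMap.toMatrix' β.symm.toLinearMap)
      (by rw [← LinearMap.toMatrix'_comp]; simp)
  · exact IsUnit.of_mul_eq_one (LinearMap.toMatrix' α.symm.toLinearMap)
      (by rw [← LinearMap.toMatrix'_comp]; simp)
  · have : B.mulVecLin = β.toLinearMap ∘ₗ A.mulVecLin ∘ₗ α.toLinearMap := by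
      ext1 x; exact LinearMap.ext fun y => hαβ _
    have := congrArg LinearMap.toMatrix' this
    rwa [LinearMap.toMatrix'_comp, LinearMap.toMatrix'_comp, ← Matrix.toLin'_apply', ← Matrix.toLin'_apply',
      LinearMap.toMatrix'_toLin', LinearMap.toMatrix'_toLin', ← Matrix.mul_assoc] at this

/-- A set any two of whose points lie on a polynomial curve contained generically in the set
has prime vanishing ideal. -/
theorem MvPolynomial.vanishing_or_vanishing_of_curves {K σ α : Type*} [Field K] [Infinite K]
    (X : Set α) (φ : α → σ → K)
    (hX : ∀ A ∈ X, ∀ B ∈ X, ∃ (Q : σ → Polynomial K) (h : Polynomial K), h ≠ 0 ∧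
      (∀ x, (Q x).eval 0 = φ A x) ∧ (∀ x, (Q x).eval 1 = φ B x) ∧
      ∀ t, h.eval t ≠ 0 → ∃ C ∈ X, ∀ x, (Q x).eval t = φ C x)
    (Φ Ψ : MvPolynomial σ K) (hΦΨ : ∀ A ∈ X, MvPolynomial.eval (φ A) (Φ * Ψ) = 0) :
    (∀ A ∈ X, MvPolynomial.eval (φ A) Φ = 0) ∨ (∀ A ∈ X, MvPolynomial.eval (φ A) Ψ = 0) := by
  by_contra! hne
  obtain ⟨⟨A, hA, hΦA⟩, ⟨B, hB, hΨB⟩⟩ := hne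
  obtain ⟨Q, h, hh, hQA, hQB, hQ⟩ := hX A hA B hB
  have key : ∀ (Θ : MvPolynomial σ K) (C : α) (t : K), (∀ x, (Q x).eval t = φ C x) →
      (MvPolynomial.aeval Q Θ).eval t = MvPolynomial.eval (φ C) Θ := by
    intro Θ C t ht
    have hφ : φ C = fun x => (Q x).eval t := by
      ext x; exact (ht x).symm
    rw [hφ, ← Polynomial.coe_evalRingHom, MvPolynomial.aeval_def,
      ← MvPolynomial.coe_eval₂Hom, MvPolynomial.eval, ← RingHom.comp_apply]
    congr 1
    ext <;> simp
  have hP : h * (MvPolynomial.aeval Q Φ * MvPolynomial.aeval Q Ψ) ≠ 0 := by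
    refine mul_ne_zero hh (mul_ne_zero ?_ ?_)
    · intro h0
      apply hΦA
      rw [← key Φ A 0 hQA, h0, Polynomial.eval_zero]
    · intro h0
      apply hΨB
      rw [← key Ψ B 1 hQB, h0, Polynomial.eval_zero]
  obtain ⟨t, ht⟩ : ∃ t, (h * (MvPolynomial.aeval Q Φ * MvPolynomial.aeval Q Ψ)).eval t ≠ 0 := by
    by_contra! h0
    exact hP (Polynomial.funext fun t => by simpa using h0 t)
  rw [Polynomial.eval_mul] at ht
  obtain ⟨C, hC, hQC⟩ := hQ t (left_ne_zero_of_mul ht)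
  apply right_ne_zero_of_mul ht
  rw [← map_mul, key _ C t hQC, hΦΨ C hC]

/-- The affine line through two matrices, as a matrix of polynomials. -/
noncomputable def polyLine {K m n : Type*} [Field K] (A B : Matrix m n K) :
    Matrix m n (Polynomial K) :=
  Matrix.of fun i j => Polynomial.C (A i j) + Polynomial.X * Polynomial.C (B i j - A i j)

theorem map_eval_polyLine {K m n : Type*} [Field K] (A B : Matrix m n K) (t : K) :
    (polyLine A B).map (Polynomial.evalRingHom t) = A + t • (B - A) := by
  ext i j; simp [polyLine]

theorem eval_det_polyLine {K m : Type*} [Field K] [Fintype m] [DecidableEq m]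
    (A B : Matrix m m K) (t : K) :
    (polyLine A B).det.eval t = (A + t • (B - A)).det := by
  rw [← map_eval_polyLine, ← Polynomial.coe_evalRingHom, RingHom.map_det, RingHom.mapMatrix_apply]

theorem det_polyLine_ne_zero {K m : Type*} [Field K] [Fintype m] [DecidableEq m]
    {A B : Matrix m m K} (hA : A.det ≠ 0) : (polyLine A B).det ≠ 0 := by
  intro h0
  apply hA
  have := eval_det_polyLine A B 0
  simpa [h0] using this.symm

/-- The matrices in a tuple have no common nonzero left kernel vector. -/
def TrivialCommonCokernel {K N l m : Type*} [Field K] [Fintype l] (D : N → Matrix l m K) : Prop :=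
  ∀ v : l → K, (∀ i, v ᵥ* D i = 0) → v = 0

theorem iSup_range_mulVecLin_eq_top_iff {K N l m : Type*} [Field K] [Fintype l] [DecidableEq l]
    [Fintype m] [DecidableEq m] (D : N → Matrix l m K) :
    (⨆ i, LinearMap.range (Matrix.mulVecLin (D i))) = ⊤ ↔ TrivialCommonCokernel D := by
  constructor
  · intro h v hv
    have hle : (⨆ i, LinearMap.range (Matrix.mulVecLin (D i))) ≤
        LinearMap.ker (dotProductBilin K K v) := by
      refine iSup_le fun i => ?_
      rintro _ ⟨w, rfl⟩
      simp [Matrix.dotProduct_mulVec, hv i]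
    rw [h, top_le_iff] at hle
    refine dotProduct_eq_zero v fun w => ?_
    have : w ∈ LinearMap.ker (dotProductBilin K K v) := by rw [hle]; trivial
    simpa using this
  · intro h
    by_contra hne
    obtain ⟨f, hf, hle⟩ := Submodule.exists_le_ker_of_lt_top _ (lt_top_iff_ne_top.2 hne)
    have hfv : ∀ w, f w = (fun a => f (Pi.single a 1)) ⬝ᵥ w := by
      intro w
      conv_lhs => rw [pi_eq_sum_univ' w]
      simp [dotProduct, map_sum, mul_comm]
    apply hf
    have h0 : (fun a => f (Pi.single a 1)) = 0 := by
      apply h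
      intro i
      refine dotProduct_eq_zero _ fun w => ?_
      rw [← Matrix.dotProduct_mulVec, ← hfv]
      exact hle (Submodule.mem_iSup_of_mem i ⟨w, rfl⟩)
    ext1 a
    simp only [h0] at hfv
    ext
    simp [hfv]

theorem TrivialCommonCokernel.exists_polynomial {K N l m : Type*} [Field K]
    [Fintype l] [DecidableEq l] [Fintype N] [DecidableEq N] [Fintype m] [DecidableEq m]
    {D : N → Matrix l m K} (hD : TrivialCommonCokernel D) (D' : N → Matrix l m K) :
    ∃ h : Polynomial K, h ≠ 0 ∧
      ∀ t, h.eval t ≠ 0 → TrivialCommonCokernel (fun i => D i + t • (D' i - D i)) := by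
  let J : (N → Matrix l m K) → Matrix l (N × m) K := fun D => Matrix.of fun a x => D x.1 a x.2
  have hJ : ∀ D, Function.Injective (J D).vecMul ↔ TrivialCommonCokernel D := by
    intro D
    have h0 : ∀ v, v ᵥ* J D = 0 ↔ ∀ i, v ᵥ* D i = 0 := fun v =>
      ⟨fun h i => funext fun k => congrFun h (i, k), fun h => funext fun x => congrFun (h x.1) x.2⟩
    rw [← Matrix.coe_vecMulLinear, injective_iff_map_eq_zero]
    simp only [Matrix.coe_vecMulLinear, h0]
    rfl
  have hinj := (hJ D).2 hD
  have : ∃ W : Matrix (N × m) l K, J D * W = 1 := by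
    obtain ⟨L, hL⟩ := (J D)ᵀ.mulVecLin.exists_leftInverse_of_injective (by
      rw [LinearMap.ker_eq_bot, Matrix.coe_mulVecLin]
      have : (J D)ᵀ.mulVec = (J D).vecMul := funext fun v => Matrix.mulVec_transpose _ _
      rwa [this])
    refine ⟨(LinearMap.toMatrix' L)ᵀ, ?_⟩
    have := congrArg LinearMap.toMatrix' hL
    rw [LinearMap.toMatrix'_comp, ← Matrix.toLin'_apply', LinearMap.toMatrix'_toLin', LinearMap.toMatrix'_id] at this
    rw [← Matrix.transpose_inj, Matrix.transpose_mul, Matrix.transpose_transpose, this,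
      Matrix.transpose_one]
  obtain ⟨W, hW⟩ := this
  refine ⟨(polyLine (J D * W) (J D' * W)).det, det_polyLine_ne_zero (by simp [hW]), fun t ht => ?_⟩
  rw [eval_det_polyLine] at ht
  rw [← hJ]
  have hE : J (fun i => D i + t • (D' i - D i)) = J D + t • (J D' - J D) := by
    ext; simp [J]
  rw [hE]
  set E := J D + t • (J D' - J D)
  have hEW : J D * W + t • (J D' * W - J D * W) = E * W := by
    simp [E, Matrix.add_mul, Matrix.sub_mul]
  rw [hEW] at ht
  have hu : IsUnit (E * W) := (Matrix.isUnit_iff_isUnit_det _).2 ht.isUnit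
  have := Matrix.vecMul_injective_of_isUnit hu
  intro v w hvw
  apply this
  simp only at hvw
  change v ᵥ* (E * W) = w ᵥ* (E * W)
  rw [← Matrix.vecMul_vecMul, ← Matrix.vecMul_vecMul]
  exact congrArg (· ᵥ* W) hvw

/-- The index type of `d × d` matrices partitioned into blocks of sizes 1, r, n, 1. -/
abbrev BlockIndex (r n : ℕ) : Type := Fin 1 ⊕ (Fin r ⊕ (Fin n ⊕ Fin 1))

theorem blockMat1rn1_add_smul_sub {K : Type*} [Field K] {r n : ℕ} (b : Fin r → K)
    (c c' : Fin n → K) (D D' : Matrix (Fin r) (Fin n) K) (f : Fin n → K) (t : K) :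
    blockMat1rn1 b (c + t • (c' - c)) (D + t • (D' - D)) f =
      blockMat1rn1 b c D f + t • (blockMat1rn1 b c' D' f - blockMat1rn1 b c D f) := by
  ext (p | p | p | p) (q | q | q | q) <;> simp [blockMat1rn1]

theorem sum_smul_blockMat1rn1 {K ι : Type*} [Field K] [Fintype ι] {r n : ℕ} (g : ι → K)
    (b : ι → Fin r → K) (c : ι → Fin n → K) (D : ι → Matrix (Fin r) (Fin n) K)
    (f : ι → Fin n → K) :
    ∑ j, g j • blockMat1rn1 (b j) (c j) (D j) (f j) =
      blockMat1rn1 (∑ j, g j • b j) (∑ j, g j • c j) (∑ j, g j • D j) (∑ j, g j • f j) := by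
  ext (p | p | p | p) (q | q | q | q) <;> simp [blockMat1rn1, Matrix.sum_apply]

theorem commute_blockMat1rn1_iff {K : Type*} [Field K] {r n : ℕ} (b b' : Fin r → K)
    (c c' : Fin n → K) (D D' : Matrix (Fin r) (Fin n) K) (f f' : Fin n → K) :
    Commute (blockMat1rn1 b c D f) (blockMat1rn1 b' c' D' f') ↔
      b ᵥ* D' = b' ᵥ* D ∧ c ⬝ᵥ f' = c' ⬝ᵥ f ∧ D *ᵥ f' = D' *ᵥ f := by
  constructor
  · intro h
    refine ⟨funext fun k => ?_, ?_, funext fun a => ?_⟩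
    · simpa [blockMat1rn1, Matrix.mul_apply, Matrix.vecMul, dotProduct] using
        congrFun (congrFun h.eq (Sum.inl 0)) (Sum.inr (Sum.inr (Sum.inl k)))
    · simpa [blockMat1rn1, Matrix.mul_apply, dotProduct] using
        congrFun (congrFun h.eq (Sum.inl 0)) (Sum.inr (Sum.inr (Sum.inr 0)))
    · simpa [blockMat1rn1, Matrix.mul_apply, Matrix.mulVec, dotProduct] using
        congrFun (congrFun h.eq (Sum.inr (Sum.inl a))) (Sum.inr (Sum.inr (Sum.inr 0)))
  · rintro ⟨h1, h2, h3⟩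
    have h1' := fun k => congrFun h1 k
    have h3' := fun a => congrFun h3 a
    simp only [Matrix.vecMul, Matrix.mulVec, dotProduct] at h1' h2 h3'
    ext (p | p | p | p) (q | q | q | q) <;>
      simp [blockMat1rn1, Matrix.mul_apply, h1', h2, h3']

/-- The block diagonal matrix with diagonal blocks `1`, `M`, `N`, `1`. -/
def blockDiag1rn1 {K : Type*} [Field K] {r n : ℕ} (M : Matrix (Fin r) (Fin r) K)
    (N : Matrix (Fin n) (Fin n) K) : Matrix (BlockIndex r n) (BlockIndex r n) K :=
  Matrix.fromBlocks 1 0 0 (Matrix.fromBlocks M 0 0 (Matrix.fromBlocks N 0 0 1))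

theorem isUnit_blockDiag1rn1 {K : Type*} [Field K] {r n : ℕ} {M : Matrix (Fin r) (Fin r) K}
    {N : Matrix (Fin n) (Fin n) K} (hM : IsUnit M) (hN : IsUnit N) :
    IsUnit (blockDiag1rn1 M N) := by
  rw [Matrix.isUnit_iff_isUnit_det] at hM hN ⊢
  simpa [blockDiag1rn1, Matrix.det_fromBlocks_zero₂₁] using ⟨hM.ne_zero, hN.ne_zero⟩

theorem blockDiag1rn1_mul_blockMat1rn1 {K : Type*} [Field K] {r n : ℕ}
    (M : Matrix (Fin r) (Fin r) K) (N : Matrix (Fin n) (Fin n) K) (b : Fin r → K)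
    (c : Fin n → K) {D D' : Matrix (Fin r) (Fin n) K} (hD : M * D = D' * N) (f : Fin n → K) :
    blockDiag1rn1 M N * blockMat1rn1 (b ᵥ* M) (c ᵥ* N) D f =
      blockMat1rn1 b c D' (N *ᵥ f) * blockDiag1rn1 M N := by
  have hD' := fun a k => congrFun (congrFun hD a) k
  simp only [Matrix.mul_apply] at hD'
  ext (p | p | p | p) (q | q | q | q) <;>
    simp [blockMat1rn1, blockDiag1rn1, Matrix.mul_apply, Matrix.vecMul, Matrix.mulVec, dotProduct,
      Matrix.one_apply, hD'] <;>
    exact fun h => absurd (Subsingleton.elim _ _) h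

/-- The normal form of an `n × r` matrix of rank `s`, as a tuple of rows. -/
def rankNormalRow (K : Type*) [Field K] (n r s : ℕ) (i : Fin n) (a : Fin r) : K :=
  if (i : ℕ) = a ∧ (a : ℕ) < s then 1 else 0

theorem rank_rankNormalRow (K : Type*) [Field K] {n r s : ℕ} (hsr : s ≤ r) (hrn : r ≤ n) :
    (Matrix.of (rankNormalRow K n r s)).rank = s := by
  have hli : LinearIndependent K
      (fun l : Fin s => (Pi.single (Fin.castLE hsr l) 1 : Fin r → K)) := by
    have := (Pi.basisFun K (Fin r)).linearIndependent.comp _ (Fin.castLE_injective hsr)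
    convert this using 1
    ext l; simp
  have hspan : Submodule.span K (Set.range (rankNormalRow K n r s)) =
      Submodule.span K (Set.range
        (fun l : Fin s => (Pi.single (Fin.castLE hsr l) 1 : Fin r → K))) := by
    apply le_antisymm
    · rw [Submodule.span_le]
      rintro _ ⟨i, rfl⟩
      by_cases hi : (i : ℕ) < s
      · refine Submodule.subset_span ⟨⟨i, hi⟩, ?_⟩
        ext a
        by_cases ha : (i : ℕ) = a
        · have : a = Fin.castLE hsr ⟨i, hi⟩ := Fin.ext ha.symm
          simp [rankNormalRow, this, hi]
        · have : a ≠ Fin.castLE hsr ⟨i, hi⟩ := fun h => ha (by simp [h])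
          change (Pi.single (Fin.castLE hsr ⟨i, hi⟩) 1 : Fin r → K) a = _
          rw [Pi.single_eq_of_ne this]
          simp [rankNormalRow, ha]
      · have : rankNormalRow K n r s i = 0 := by
          ext a
          simp only [rankNormalRow, Pi.zero_apply, ite_eq_right_iff, one_ne_zero, imp_false]
          omega
        simp [this]
    · rw [Submodule.span_le]
      rintro _ ⟨l, rfl⟩
      refine Submodule.subset_span ⟨Fin.castLE (hsr.trans hrn) l, ?_⟩
      ext a
      by_cases ha : a = Fin.castLE hsr l
      · simp [rankNormalRow, ha]
      · have : (l : ℕ) ≠ a := fun h => ha (Fin.ext h.symm)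
        simp [rankNormalRow, this, ha]
  rw [Matrix.rank_eq_finrank_span_row]
  change Module.finrank K (Submodule.span K (Set.range (rankNormalRow K n r s))) = s
  rw [hspan, finrank_span_eq_card hli, Fintype.card_fin]

/-- The tuple of block matrices whose blocks `b` and `f` are in normal form. -/
def normalTuple {K : Type*} [Field K] {n r : ℕ} (s : ℕ) (c : Fin n → Fin n → K)
    (D : Fin n → Matrix (Fin r) (Fin n) K) (i : Fin n) :
    Matrix (BlockIndex r n) (BlockIndex r n) K :=
  blockMat1rn1 (rankNormalRow K n r s i) (c i) (D i) (Pi.single i 1)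

/-- The blocks `c` and `D` complete the normal form of `b` and `f` to a point of the locus. -/
def IsNormalData {K : Type*} [Field K] {n r : ℕ} (s : ℕ) (c : Fin n → Fin n → K)
    (D : Fin n → Matrix (Fin r) (Fin n) K) : Prop :=
  (∀ i j, Commute (normalTuple s c D i) (normalTuple s c D j)) ∧ TrivialCommonCokernel D

theorem exists_isNormalData (K : Type*) [Field K] {n r : ℕ} (s : ℕ) (hrn : r ≤ n) :
    ∃ (c : Fin n → Fin n → K) (D : Fin n → Matrix (Fin r) (Fin n) K), IsNormalData s c D := by
  refine ⟨0, fun i => Matrix.of fun a k => if (a : ℕ) = i ∧ i = k then 1 else 0,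
    fun i j => ?_, fun v hv => funext fun a => ?_⟩
  · refine (commute_blockMat1rn1_iff ..).2 ⟨funext fun k => ?_, by simp, funext fun a => ?_⟩
    · simp only [Matrix.vecMul, dotProduct, rankNormalRow, Matrix.of_apply]
      refine Finset.sum_congr rfl fun a _ => ?_
      by_cases h : i = j
      · rw [h]
      · have : (i : ℕ) ≠ j := fun h' => h (Fin.ext h')
        split_ifs <;> first | omega | simp
    · simp only [Matrix.mulVec, dotProduct_single_one, Matrix.of_apply]
      by_cases h : i = j
      · rw [h]
      · simp [h, Ne.symm h]
  · have := congrFun (hv (Fin.castLE hrn a)) (Fin.castLE hrn a)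
    simpa [Matrix.vecMul, dotProduct, ← Fin.ext_iff] using this

theorem IsNormalData.line {K : Type*} [Field K] {n r s : ℕ} {c c' : Fin n → Fin n → K}
    {D D' : Fin n → Matrix (Fin r) (Fin n) K} (h : IsNormalData s c D)
    (h' : IsNormalData s c' D') (t : K)
    (ht : TrivialCommonCokernel (fun i => D i + t • (D' i - D i))) :
    IsNormalData s (fun i => c i + t • (c' i - c i)) (fun i => D i + t • (D' i - D i)) := by
  refine ⟨fun i j => ?_, ht⟩
  obtain ⟨h1, h2, h3⟩ := (commute_blockMat1rn1_iff ..).1 (h.1 i j)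
  obtain ⟨h1', h2', h3'⟩ := (commute_blockMat1rn1_iff ..).1 (h'.1 i j)
  refine (commute_blockMat1rn1_iff ..).2 ⟨?_, ?_, ?_⟩
  · simp only [Matrix.vecMul_add, Matrix.vecMul_smul, Matrix.vecMul_sub, h1, h1']
  · simp only [add_dotProduct, smul_dotProduct, sub_dotProduct, h2, h2']
  · simp only [Matrix.add_mulVec, Matrix.smul_mulVec, Matrix.sub_mulVec, h3, h3']

theorem Commute.sum_smul_sum_smul {K R ι : Type*} [CommSemiring K] [Semiring R] [Algebra K R]
    [Fintype ι] {Y : ι → R} (hY : ∀ i j, Commute (Y i) (Y j)) (g h : ι → K) :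
    Commute (∑ j, g j • Y j) (∑ j, h j • Y j) :=
  Commute.sum_left _ _ _ fun i _ => Commute.sum_right _ _ _ fun j _ =>
    ((hY i j).smul_left _).smul_right _

/-- Conjugate by `P` the tuple of linear combinations of `Y` with coefficients in the rows of `G`,
replacing the inverse of `P` by its adjugate. -/
def adjugateConj {R ι : Type*} [CommRing R] [Fintype ι] [DecidableEq ι] {n : ℕ}
    (P : Matrix ι ι R) (G : Matrix (Fin n) (Fin n) R) (Y : Fin n → Matrix ι ι R) (i : Fin n) :
    Matrix ι ι R :=
  P * (∑ j, G i j • Y j) * P.adjugate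

theorem adjugateConj_map {R S ι : Type*} [CommRing R] [CommRing S] [Fintype ι] [DecidableEq ι]
    {n : ℕ} (φ : R →+* S) (P : Matrix ι ι R) (G : Matrix (Fin n) (Fin n) R)
    (Y : Fin n → Matrix ι ι R) (i : Fin n) :
    (adjugateConj P G Y i).map φ =
      adjugateConj (P.map φ) (G.map φ) (fun j => (Y j).map φ) i := by
  have h : (∑ j, G i j • Y j).map φ = ∑ j, G.map φ i j • (Y j).map φ := by
    ext p q; simp [Matrix.sum_apply]
  rw [adjugateConj, adjugateConj, Matrix.map_mul, Matrix.map_mul, h]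
  congr 1
  exact φ.map_adjugate P

theorem adjugateConj_mem_locusX {K : Type*} [Field K] {n r s : ℕ} (hsr : s ≤ r) (hrn : r ≤ n)
    {P : Matrix (BlockIndex r n) (BlockIndex r n) K} {G : Matrix (Fin n) (Fin n) K}
    {c : Fin n → Fin n → K} {D : Fin n → Matrix (Fin r) (Fin n) K}
    (hP : P.det ≠ 0) (hG : G.det ≠ 0) (h : IsNormalData s c D) :
    adjugateConj P G (normalTuple s c D) ∈ locusX (K := K) n r s := by
  set G' : Matrix (Fin n) (Fin n) K := P.det • G with hG'
  have hG'u : IsUnit G' := by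
    rw [Matrix.isUnit_iff_isUnit_det, hG', Matrix.det_smul]
    exact (mul_ne_zero (pow_ne_zero _ hP) hG).isUnit
  have hPu : IsUnit P.det := hP.isUnit
  have hadj : P.adjugate = P.det • P⁻¹ := by
    rw [Matrix.inv_def, smul_smul, Ring.mul_inverse_cancel _ hPu, one_smul]
  have hA : ∀ i, adjugateConj P G (normalTuple s c D) i =
      P * (∑ j, G' i j • normalTuple s c D j) * P⁻¹ := by
    intro i
    rw [adjugateConj, hadj, hG', Matrix.mul_smul, ← Matrix.smul_mul, ← Matrix.mul_smul,
      Finset.smul_sum]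
    simp only [smul_smul, Matrix.smul_apply, smul_eq_mul]
  refine ⟨fun i j => ?_, P, (Matrix.isUnit_iff_isUnit_det _).2 hPu,
    fun i => ∑ j, G' i j • rankNormalRow K n r s j, fun i => ∑ j, G' i j • c j,
    fun i => ∑ j, G' i j • D j, fun i => ∑ j, G' i j • Pi.single j 1,
    fun i => ?_, ?_, ?_, ?_⟩
  · have hc := (Commute.sum_smul_sum_smul h.1 (G' i) (G' j)).eq
    rw [hA, hA]
    simp only [Matrix.mul_assoc, Matrix.nonsing_inv_mul_cancel_left _ _ hPu]
    simp only [← Matrix.mul_assoc _ _ P⁻¹, hc]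
  · rw [hA, ← sum_smul_blockMat1rn1]
    simp only [Matrix.mul_assoc, Matrix.nonsing_inv_mul_cancel_left _ _ hPu,
      Matrix.nonsing_inv_mul _ hPu, Matrix.mul_one]
    rfl
  · have : (fun i => ∑ j, G' i j • (Pi.single j 1 : Fin n → K)) = G'.row := by
      ext i k
      simp [Pi.single_apply]
    rw [this]
    exact Matrix.linearIndependent_rows_iff_isUnit.2 hG'u
  · rw [iSup_range_mulVecLin_eq_top_iff]
    intro v hv
    apply h.2
    have h0 : G' * (Matrix.of fun j k => (v ᵥ* D j) k) = 0 := by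
      ext i k
      have := congrFun (hv i) k
      simpa [Matrix.vecMul_sum, Matrix.vecMul_smul, Matrix.mul_apply] using this
    have h1 : (Matrix.of fun j k => (v ᵥ* D j) k) = 0 := hG'u.mul_right_eq_zero.1 h0
    exact fun i => congrFun h1 i
  · have h0 : (fun i => ∑ j, G' i j • rankNormalRow K n r s j) =
        (G' * Matrix.of (rankNormalRow K n r s)).row := by
      ext i a
      simp [Matrix.mul_apply]
    rw [h0, ← Matrix.rank_eq_finrank_span_row, Matrix.rank_mul_eq_right_of_isUnit_det,
      rank_rankNormalRow K hsr hrn]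
    exact (Matrix.isUnit_iff_isUnit_det _).1 hG'u

theorem exists_adjugateConj_of_mem_locusX {K : Type*} [Field K] {n r s : ℕ} (hsr : s ≤ r)
    (hrn : r ≤ n) {A : Fin n → Matrix (BlockIndex r n) (BlockIndex r n) K}
    (hA : A ∈ locusX (K := K) n r s) :
    ∃ (P : Matrix (BlockIndex r n) (BlockIndex r n) K) (G : Matrix (Fin n) (Fin n) K)
      (c : Fin n → Fin n → K) (D : Fin n → Matrix (Fin r) (Fin n) K),
      P.det ≠ 0 ∧ G.det ≠ 0 ∧ IsNormalData s c D ∧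
        A = adjugateConj P G (normalTuple s c D) := by
  obtain ⟨hcomm, P, hP, b, c, D, f, hblock, hf, hD, hb⟩ := hA
  rw [iSup_range_mulVecLin_eq_top_iff] at hD
  have hF : IsUnit (Matrix.of f) := Matrix.linearIndependent_rows_iff_isUnit.1 hf
  have hrank : (Matrix.of (rankNormalRow K n r s)).rank = (Matrix.of b).rank := by
    rw [rank_rankNormalRow K hsr hrn, Matrix.rank_eq_finrank_span_row]
    exact hb.symm
  obtain ⟨G, M, hG, hM, hGM⟩ := Matrix.exists_isUnit_mul_mul_eq_of_rank_eq _ _ hrank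
  have hGdet := (Matrix.isUnit_iff_isUnit_det _).1 hG
  have hMdet := (Matrix.isUnit_iff_isUnit_det _).1 hM
  have hPdet := (Matrix.isUnit_iff_isUnit_det _).1 hP
  set H := G⁻¹ with hH
  set N : Matrix (Fin n) (Fin n) K := (H * Matrix.of f)ᵀ with hN
  have hNu : IsUnit N := by
    rw [hN, Matrix.isUnit_transpose]
    exact ((Matrix.isUnit_nonsing_inv_iff).2 hG).mul hF
  have hMinv : IsUnit M⁻¹ := (Matrix.isUnit_nonsing_inv_iff).2 hM
  set R := blockDiag1rn1 M⁻¹ N with hR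
  have hRu : IsUnit R := isUnit_blockDiag1rn1 hMinv hNu
  set c' : Fin n → Fin n → K := fun k => (∑ j, H k j • c j) ᵥ* N with hc'
  set D' : Fin n → Matrix (Fin r) (Fin n) K := fun k => M * (∑ j, H k j • D j) * N with hD'
  set Bl := fun j => blockMat1rn1 (b j) (c j) (D j) (f j) with hBl
  have hRY : ∀ k, R * normalTuple s c' D' k = (∑ j, H k j • Bl j) * R := by
    intro k
    rw [sum_smul_blockMat1rn1]
    have hb' : rankNormalRow K n r s k = (∑ j, H k j • b j) ᵥ* M⁻¹ := by
      have : Matrix.of (rankNormalRow K n r s) = H * Matrix.of b * M⁻¹ := by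
        rw [hGM, Matrix.mul_assoc G, Matrix.nonsing_inv_mul_cancel_left _ _ hGdet,
          Matrix.mul_nonsing_inv_cancel_right _ _ hMdet]
      have h1 : (∑ j, H k j • b j) = (H * Matrix.of b) k := by
        ext a; simp [Matrix.mul_apply]
      rw [h1]
      exact congrFun this k
    have hf' : (∑ j, H k j • f j) = N *ᵥ Pi.single k 1 := by
      ext a; simp [hN, Matrix.mul_apply, mul_comm]
    rw [normalTuple, hb', hf']
    refine blockDiag1rn1_mul_blockMat1rn1 _ _ _ _ ?_ _
    change M⁻¹ * (M * (∑ j, H k j • D j) * N) = _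
    rw [Matrix.mul_assoc M, Matrix.nonsing_inv_mul_cancel_left _ _ hMdet]
  have hRdet := (Matrix.isUnit_iff_isUnit_det _).1 hRu
  set Q := P * R with hQ
  have hQu : IsUnit Q := hP.mul hRu
  have hQdet := (Matrix.isUnit_iff_isUnit_det _).1 hQu
  have hPA : ∀ i, P * Bl i = A i * P := by
    intro i
    change P * blockMat1rn1 (b i) (c i) (D i) (f i) = A i * P
    rw [← hblock i, Matrix.mul_assoc, Matrix.mul_nonsing_inv_cancel_left _ _ hPdet]
  have hQY : ∀ k, Q * normalTuple s c' D' k = (∑ j, H k j • A j) * Q := by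
    intro k
    rw [hQ, Matrix.mul_assoc, hRY, ← Matrix.mul_assoc, ← Matrix.mul_assoc]
    simp only [Matrix.mul_sum, Matrix.sum_mul, Matrix.mul_smul, Matrix.smul_mul, hPA]
  have hY : ∀ k, normalTuple s c' D' k = Q⁻¹ * ((∑ j, H k j • A j) * Q) := by
    intro k
    rw [← hQY, Matrix.nonsing_inv_mul_cancel_left _ _ hQdet]
  refine ⟨Q, Q.det⁻¹ • G, c', D', hQdet.ne_zero, ?_, ⟨fun i j => ?_, fun v hv => ?_⟩, ?_⟩
  · rw [Matrix.det_smul]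
    exact mul_ne_zero (pow_ne_zero _ (inv_ne_zero hQdet.ne_zero)) hGdet.ne_zero
  · have hc := (Commute.sum_smul_sum_smul (Y := A) hcomm (H i) (H j)).eq
    rw [hY, hY, Commute, SemiconjBy]
    simp only [Matrix.mul_assoc, Matrix.mul_nonsing_inv_cancel_left _ _ hQdet]
    simp only [← Matrix.mul_assoc _ _ Q, hc]
  · have h0 : H * (Matrix.of fun j k => ((v ᵥ* M) ᵥ* D j) k) = 0 := by
      ext i k
      have h1 : ((v ᵥ* M) ᵥ* (∑ j, H i j • D j)) ᵥ* N = 0 ᵥ* N := by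
        rw [Matrix.zero_vecMul, Matrix.vecMul_vecMul, Matrix.vecMul_vecMul, ← Matrix.mul_assoc]
        exact hv i
      have h2 := congrFun (Matrix.vecMul_injective_of_isUnit hNu h1) k
      simpa [Matrix.vecMul_sum, Matrix.vecMul_smul, Matrix.mul_apply] using h2
    have h1 : (Matrix.of fun j k => ((v ᵥ* M) ᵥ* D j) k) = 0 :=
      ((Matrix.isUnit_nonsing_inv_iff).2 hG).mul_right_eq_zero.1 h0
    have h2 : v ᵥ* M = 0 := hD _ fun i => congrFun h1 i
    exact Matrix.vecMul_injective_of_isUnit hM (h2.trans (Matrix.zero_vecMul M).symm)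
  · funext i
    have hsum : Q * (∑ k, G i k • normalTuple s c' D' k) = A i * Q := by
      simp only [Matrix.mul_sum, Matrix.mul_smul, hQY, ← Matrix.smul_mul, ← Matrix.sum_mul]
      congr 1
      have hGH : ∀ j, ∑ k, G i k * H k j = (1 : Matrix (Fin n) (Fin n) K) i j := by
        intro j
        rw [← Matrix.mul_nonsing_inv _ hGdet, Matrix.mul_apply]
      simp only [Finset.smul_sum, smul_smul]
      rw [Finset.sum_comm]
      simp only [← Finset.sum_smul, hGH, Matrix.one_apply, ite_smul, one_smul, zero_smul,
        Finset.sum_ite_eq, Finset.mem_univ, if_true]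
    have hsmul : ∑ j, (Q.det⁻¹ • G) i j • normalTuple s c' D' j =
        Q.det⁻¹ • ∑ j, G i j • normalTuple s c' D' j := by
      simp only [Finset.smul_sum, smul_smul, Matrix.smul_apply, smul_eq_mul]
    rw [adjugateConj, hsmul, Matrix.mul_smul, hsum, Matrix.smul_mul, Matrix.mul_assoc,
      Matrix.mul_adjugate, Matrix.mul_smul, smul_smul, inv_mul_cancel₀ hQdet.ne_zero, one_smul,
      Matrix.mul_one]

/-- Any two points of the locus lie on a polynomial curve contained generically in the locus. -/
theorem exists_curve_locusX {K : Type*} [Field K] {n r s : ℕ} (hsr : s ≤ r) (hrn : r ≤ n)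
    {A B : Fin n → Matrix (BlockIndex r n) (BlockIndex r n) K}
    (hA : A ∈ locusX (K := K) n r s) (hB : B ∈ locusX (K := K) n r s) :
    ∃ (Q : Fin n → Matrix (BlockIndex r n) (BlockIndex r n) (Polynomial K)) (h : Polynomial K),
      h ≠ 0 ∧ (∀ i, (Q i).map (Polynomial.evalRingHom 0) = A i) ∧
      (∀ i, (Q i).map (Polynomial.evalRingHom 1) = B i) ∧
      ∀ t, h.eval t ≠ 0 →
        (fun i => (Q i).map (Polynomial.evalRingHom t)) ∈ locusX (K := K) n r s := by
  obtain ⟨P, G, c, D, hP, hG, hN, rfl⟩ := exists_adjugateConj_of_mem_locusX hsr hrn hA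
  obtain ⟨P', G', c', D', hP', hG', hN', rfl⟩ := exists_adjugateConj_of_mem_locusX hsr hrn hB
  obtain ⟨h, hh, hD⟩ := hN.2.exists_polynomial D'
  refine ⟨adjugateConj (polyLine P P') (polyLine G G')
    (fun j => polyLine (normalTuple s c D j) (normalTuple s c' D' j)),
    (polyLine P P').det * (polyLine G G').det * h,
    mul_ne_zero (mul_ne_zero (det_polyLine_ne_zero hP) (det_polyLine_ne_zero hG)) hh,
    fun i => ?_, fun i => ?_, fun t ht => ?_⟩
  · simp only [adjugateConj_map, map_eval_polyLine, zero_smul, add_zero]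
  · simp only [adjugateConj_map, map_eval_polyLine, one_smul, add_sub_cancel]
  · rw [Polynomial.eval_mul, Polynomial.eval_mul, eval_det_polyLine, eval_det_polyLine] at ht
    have hline := hN.line hN' t (hD t (right_ne_zero_of_mul ht))
    have hmem := adjugateConj_mem_locusX hsr hrn (left_ne_zero_of_mul (left_ne_zero_of_mul ht))
      (right_ne_zero_of_mul (left_ne_zero_of_mul ht)) hline
    convert hmem using 2 with i
    rw [adjugateConj_map, map_eval_polyLine, map_eval_polyLine]
    congr 1
    funext j
    rw [map_eval_polyLine]
    exact (blockMat1rn1_add_smul_sub ..).symm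

/-- **Lemma 5.3 (irreducibility of X).** The locus `X^s_{n,r}` is nonempty and irreducible
for `1 ≤ s ≤ r ≤ n`. -/
theorem stmt15 {K : Type*} [Field K] [CharZero K] [IsAlgClosed K]
    {n r s : ℕ} (hs : 1 ≤ s) (hsr : s ≤ r) (hrn : r ≤ n) :
    (locusX (K := K) n r s).Nonempty ∧
    ∀ Φ Ψ : MvPolynomial (Fin n × ((Fin 1 ⊕ (Fin r ⊕ (Fin n ⊕ Fin 1))) ×
        (Fin 1 ⊕ (Fin r ⊕ (Fin n ⊕ Fin 1))))) K,
      (∀ A ∈ locusX (K := K) n r s,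
        MvPolynomial.eval (fun x => A x.1 x.2.1 x.2.2) (Φ * Ψ) = 0) →
      (∀ A ∈ locusX (K := K) n r s,
        MvPolynomial.eval (fun x => A x.1 x.2.1 x.2.2) Φ = 0) ∨
      (∀ A ∈ locusX (K := K) n r s,
        MvPolynomial.eval (fun x => A x.1 x.2.1 x.2.2) Ψ = 0) := by
  constructor
  · obtain ⟨c, D, h⟩ := exists_isNormalData K s hrn
    exact ⟨_, adjugateConj_mem_locusX (P := 1) (G := 1) hsr hrn (by simp) (by simp) h⟩
  · intro Φ Ψ
    refine MvPolynomial.vanishing_or_vanishing_of_curves (locusX (K := K) n r s)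
      (fun A (x : Fin n × (BlockIndex r n × BlockIndex r n)) => A x.1 x.2.1 x.2.2) ?_ Φ Ψ
    intro A hA B hB
    obtain ⟨Q, h, hh, hQA, hQB, hQ⟩ := exists_curve_locusX hsr hrn hA hB
    refine ⟨fun x => Q x.1 x.2.1 x.2.2, h, hh, fun x => ?_, fun x => ?_,
      fun t ht => ⟨_, hQ t ht, fun x => rfl⟩⟩
    · rw [← hQA x.1]
      rfl
    · rw [← hQB x.1]
      rfl
end

section
/- Let K be an algebraically closed field of characteristic 0, let 1 ≤ s ≤ r ≤ n, and set d = n + r + 2. Consider n-tuples (A_1,…,A_n) of pairwise commuting d×d matrices in block form (rows and columns partitioned into blocks of sizes 1, r, n, 1; only possibly nonzero blocks: the (1,2) block b_iᵀ with b_i ∈ K^r, the (1,3) block c_iᵀ with c_i ∈ K^n, the (2,3) block D_i ∈ M_{r×n}(K), the (3,4) block f_i ∈ K^n) satisfying: f_1,…,f_n linearly independent, the images of D_1,…,D_n together spanning K^r, and dim span{b_1,…,b_n} = s. Then: (a) every such tuple satisfies dim_K ⋂_{i=1}^n ker A_i ≥ r − s + 1; and (b) there exists such a tuple with dim_K ⋂_{i=1}^n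 ker A_i = r − s + 1. (The minimal — hence generic — socle dimension of an algebra corresponding to an n-tuple from X^s_{n,r} is r − s + 1.) -/
open Matrix

/-- The vectors of the first two blocks, the second component being orthogonal to all `b i`. -/
def blockSocle {K : Type*} [Field K] {r n : ℕ} (b : Fin n → Fin r → K) :
    K × LinearMap.ker (Matrix.of b).mulVecLin →ₗ[K]
      (Fin 1 ⊕ (Fin r ⊕ (Fin n ⊕ Fin 1)) → K) where
  toFun p := Sum.elim (fun _ => p.1) (Sum.elim p.2.1 0)
  map_add' p q := by ext (_ | _ | _) <;> simp
  map_smul' a p := by ext (_ | _ | _) <;> simp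

theorem blockSocle_injective {K : Type*} [Field K] {r n : ℕ} (b : Fin n → Fin r → K) :
    Function.Injective (blockSocle b) := by
  intro p q h
  refine Prod.ext (congrFun h (Sum.inl 0)) (Subtype.ext (funext fun a => ?_))
  exact congrFun h (Sum.inr (Sum.inl a))

theorem finrank_range_blockSocle {K : Type*} [Field K] {r n : ℕ} (b : Fin n → Fin r → K) :
    Module.finrank K (LinearMap.range (blockSocle b)) =
      r - Module.finrank K (Submodule.span K (Set.range b)) + 1 := by
  rw [LinearMap.finrank_range_of_inj (blockSocle_injective b), Module.finrank_prod,
    Module.finrank_self]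
  have h := LinearMap.finrank_range_add_finrank_ker (Matrix.of b).mulVecLin
  have h' : Module.finrank K (LinearMap.range (Matrix.of b).mulVecLin) =
      Module.finrank K (Submodule.span K (Set.range b)) :=
    (Matrix.of b).rank_eq_finrank_span_row
  rw [h', Module.finrank_fin_fun] at h
  omega

theorem blockMat1rn1_mulVec_eq_zero_iff {K : Type*} [Field K] {r n : ℕ} (b : Fin r → K)
    (c : Fin n → K) (D : Matrix (Fin r) (Fin n) K) (f : Fin n → K)
    (x : Fin 1 ⊕ (Fin r ⊕ (Fin n ⊕ Fin 1)) → K) :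
    blockMat1rn1 b c D f *ᵥ x = 0 ↔
      (∑ a, b a * x (.inr (.inl a)) + ∑ k, c k * x (.inr (.inr (.inl k))) = 0) ∧
      (∀ a, ∑ k, D a k * x (.inr (.inr (.inl k))) = 0) ∧
      (∀ k, f k * x (.inr (.inr (.inr 0))) = 0) := by
  simp [funext_iff, Sum.forall, Matrix.mulVec, dotProduct, blockMat1rn1, Fintype.sum_sum_type]

theorem mem_iInf_ker_blockMat1rn1 {K : Type*} [Field K] {r n : ℕ} {b : Fin n → Fin r → K}
    {c : Fin n → Fin n → K} {D : Fin n → Matrix (Fin r) (Fin n) K} {f : Fin n → Fin n → K}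
    {x : Fin 1 ⊕ (Fin r ⊕ (Fin n ⊕ Fin 1)) → K} :
    x ∈ ⨅ i, LinearMap.ker (blockMat1rn1 (b i) (c i) (D i) (f i)).mulVecLin ↔ ∀ i,
      (∑ a, b i a * x (.inr (.inl a)) + ∑ k, c i k * x (.inr (.inr (.inl k))) = 0) ∧
      (∀ a, ∑ k, D i a k * x (.inr (.inr (.inl k))) = 0) ∧
      (∀ k, f i k * x (.inr (.inr (.inr 0))) = 0) := by
  simp only [Submodule.mem_iInf, LinearMap.mem_ker, Matrix.mulVecLin_apply,
    blockMat1rn1_mulVec_eq_zero_iff]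

theorem range_blockSocle_le {K : Type*} [Field K] {r n : ℕ} (b : Fin n → Fin r → K)
    (c : Fin n → Fin n → K) (D : Fin n → Matrix (Fin r) (Fin n) K) (f : Fin n → Fin n → K) :
    LinearMap.range (blockSocle b) ≤
      ⨅ i, LinearMap.ker (blockMat1rn1 (b i) (c i) (D i) (f i)).mulVecLin := by
  rintro _ ⟨⟨t, v, hv⟩, rfl⟩
  rw [mem_iInf_ker_blockMat1rn1]
  intro i
  have h : ∑ a, b i a * v a = 0 := congrFun (LinearMap.mem_ker.mp hv) i
  simp [blockSocle, h]

/-- If the common kernel lies in the first two blocks, it is the range of `blockSocle`. -/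
theorem iInf_ker_blockMat1rn1_eq {K : Type*} [Field K] {r n : ℕ} {b : Fin n → Fin r → K}
    {c : Fin n → Fin n → K} {D : Fin n → Matrix (Fin r) (Fin n) K} {f : Fin n → Fin n → K}
    (h : ∀ x ∈ ⨅ i, LinearMap.ker (blockMat1rn1 (b i) (c i) (D i) (f i)).mulVecLin,
      ∀ k, x (.inr (.inr k)) = 0) :
    ⨅ i, LinearMap.ker (blockMat1rn1 (b i) (c i) (D i) (f i)).mulVecLin =
      LinearMap.range (blockSocle b) := by
  refine le_antisymm (fun x hx => ?_) (range_blockSocle_le b c D f)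
  have hk := h x hx
  rw [mem_iInf_ker_blockMat1rn1] at hx
  refine ⟨(x (.inl 0), ⟨fun a => x (.inr (.inl a)), ?_⟩), ?_⟩
  · ext i
    simpa [hk, Matrix.mulVec, dotProduct] using (hx i).1
  · ext (i | _ | _)
    · simp [blockSocle, Subsingleton.elim i 0]
    · simp [blockSocle]
    · simp [blockSocle, hk]

theorem blockMat1rn1_mul_comm {K : Type*} [Field K] {r n : ℕ} {b b' : Fin r → K}
    {c c' : Fin n → K} {D D' : Matrix (Fin r) (Fin n) K} {f f' : Fin n → K}
    (hbD : b ᵥ* D' = b' ᵥ* D) (hcf : c ⬝ᵥ f' = c' ⬝ᵥ f) (hDf : D *ᵥ f' = D' *ᵥ f) :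
    blockMat1rn1 b c D f * blockMat1rn1 b' c' D' f' =
      blockMat1rn1 b' c' D' f' * blockMat1rn1 b c D f := by
  simp only [funext_iff, Matrix.vecMul, Matrix.mulVec, dotProduct] at hbD hcf hDf
  ext (_ | _ | _ | _) (_ | _ | _ | _) <;>
    simp [Matrix.mul_apply, blockMat1rn1, Fintype.sum_sum_type, hbD, hcf, hDf]

theorem finrank_span_range_truncated_single {K : Type*} [Field K] {n r s : ℕ}
    (hsr : s ≤ r) (hrn : r ≤ n) :
    Module.finrank K (Submodule.span K (Set.range fun (i : Fin n) (a : Fin r) =>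
      if i.val = a.val ∧ i.val < s then (1 : K) else 0)) = s := by
  set b : Fin n → Fin r → K := fun i a => if i.val = a.val ∧ i.val < s then 1 else 0
  let e : Fin s → Fin r → K := fun j => Pi.single (Fin.castLE hsr j) 1
  have he : ∀ (i : Fin n) (h : i.val < s), b i = e ⟨i, h⟩ := fun i h => by
    ext a
    simp [b, e, Pi.single_apply, Fin.ext_iff, h, eq_comm]
  have hspan : Submodule.span K (Set.range b) = Submodule.span K (Set.range e) := by
    apply le_antisymm <;> rw [Submodule.span_le]
    · rintro _ ⟨i, rfl⟩
      by_cases h : i.val < s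
      · rw [he i h]
        exact Submodule.subset_span ⟨_, rfl⟩
      · have : b i = 0 := by ext a; simp [b, h]
        rw [this]
        exact Submodule.zero_mem _
    · rintro _ ⟨j, rfl⟩
      exact Submodule.subset_span ⟨Fin.castLE (hsr.trans hrn) j, he _ j.2⟩
  have hli : LinearIndependent K e :=
    (Pi.linearIndependent_single_one (Fin r) K).comp _ (Fin.castLE_injective hsr)
  rw [hspan, finrank_span_eq_card hli, Fintype.card_fin]

/-- **Lemma 5.4 / Example (socle dimension in X).** For tuples in block form from
`X^s_{n,r}`, the common kernel has dimension at least `r − s + 1`, and this bound is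
attained. -/
theorem stmt16 {K : Type*} [Field K] [CharZero K] [IsAlgClosed K]
    {n r s : ℕ} (hs : 1 ≤ s) (hsr : s ≤ r) (hrn : r ≤ n) :
    (∀ (b : Fin n → (Fin r → K)) (c : Fin n → (Fin n → K))
        (D : Fin n → Matrix (Fin r) (Fin n) K) (f : Fin n → (Fin n → K))
        (A : Fin n → Matrix (Fin 1 ⊕ (Fin r ⊕ (Fin n ⊕ Fin 1)))
          (Fin 1 ⊕ (Fin r ⊕ (Fin n ⊕ Fin 1))) K),
        A = (fun i => blockMat1rn1 (b i) (c i) (D i) (f i)) →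
        (∀ i j, A i * A j = A j * A i) →
        LinearIndependent K f →
        (⨆ i, LinearMap.range (Matrix.mulVecLin (D i))) = ⊤ →
        Module.finrank K ↥(Submodule.span K (Set.range b)) = s →
        r - s + 1 ≤ Module.finrank K ↥(⨅ i, LinearMap.ker (Matrix.mulVecLin (A i)))) ∧
    (∃ (b : Fin n → (Fin r → K)) (c : Fin n → (Fin n → K))
        (D : Fin n → Matrix (Fin r) (Fin n) K) (f : Fin n → (Fin n → K)),
        (∀ i j, (blockMat1rn1 (b i) (c i) (D i) (f i)) * (blockMat1rn1 (b j) (c j) (D j) (f j)) =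
          (blockMat1rn1 (b j) (c j) (D j) (f j)) * (blockMat1rn1 (b i) (c i) (D i) (f i))) ∧
        LinearIndependent K f ∧
        (⨆ i, LinearMap.range (Matrix.mulVecLin (D i))) = ⊤ ∧
        Module.finrank K ↥(Submodule.span K (Set.range b)) = s ∧
        Module.finrank K ↥(⨅ i, LinearMap.ker
          (Matrix.mulVecLin (blockMat1rn1 (b i) (c i) (D i) (f i)))) = r - s + 1) := by
  refine ⟨?_, ?_⟩
  · rintro b c D f A rfl - - - hb
    rw [← hb, ← finrank_range_blockSocle b]
    exact Submodule.finrank_mono (range_blockSocle_le b c D f)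
  · have hb := finrank_span_range_truncated_single (K := K) hsr hrn
    refine ⟨fun i a => if i.val = a.val ∧ i.val < s then 1 else 0, fun i => Pi.single i 1,
      fun i => Matrix.of fun a k => if i.val = a.val ∧ i = k then 1 else 0,
      fun i => Pi.single i 1, ?_, Pi.linearIndependent_single_one (Fin n) K, ?_, hb, ?_⟩
    · intro i j
      rcases eq_or_ne i j with rfl | hij
      · rfl
      have hij' : i.val ≠ j.val := fun h => hij (Fin.ext h)
      apply blockMat1rn1_mul_comm
      · ext k
        simp only [Matrix.vecMul, dotProduct, Matrix.of_apply]
        refine (Finset.sum_eq_zero fun a _ => ?_).trans (Finset.sum_eq_zero fun a _ => ?_).symm <;>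
          grind
      · simp [hij, hij.symm]
      · ext a
        simp [hij, hij.symm]
    · rw [eq_top_iff, ← (Pi.basisFun K (Fin r)).span_eq, Submodule.span_le]
      rintro _ ⟨a, rfl⟩
      refine Submodule.mem_iSup_of_mem (Fin.castLE hrn a) ⟨Pi.single (Fin.castLE hrn a) 1, ?_⟩
      ext a'
      simp [Pi.single_apply, Fin.ext_iff, eq_comm]
    · rw [iInf_ker_blockMat1rn1_eq, finrank_range_blockSocle, hb]
      intro x hx k
      rw [mem_iInf_ker_blockMat1rn1] at hx
      rcases k with k | k
      · by_cases hk : k.val < r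
        · simpa using (hx k).2.1 ⟨k, hk⟩
        · have hne : ∀ a : Fin r, k.val ≠ a.val := fun a h => hk (h ▸ a.2)
          simpa [hne, Pi.single_apply] using (hx k).1
      · have h := (hx ⟨0, by omega⟩).2.2 ⟨0, by omega⟩
        simpa [Subsingleton.elim k 0] using h
end
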